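/- arXiv:2207.04741 — 5 statements merged into one kernel-verified Lean document; each statement's English description precedes it below -/
import Mathlib

section
/- Let 0 < s < 1, Λ, δ > 0, T = L(Λ+1)δ for some positive integer L, let u be a minimizer of ℱ^T_s over 𝒜^{T,Λ,δ}, and let x₀ be a global minimum point of u. Then u' = −Λ on (x₀−δ, x₀) and ∫_{x₀−δ}^{x₀} (−Δ)^s u(x) dx ≥ 0. -/
open MeasureTheory Filter Set Topology

noncomputable section

/-- A function `u : ℝ → ℝ` is piecewise affine: it is affine in a neighborhood of every
point outside a closed discrete set (the corner set). -/
def PiecewiseAffine (u : ℝ → ℝ) : Prop :=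
  ∃ S : Set ℝ, IsClosed S ∧ (∀ x ∈ S, ∃ ε > 0, S ∩ Set.Ioo (x - ε) (x + ε) ⊆ {x}) ∧
    ∀ x ∉ S, ∃ ε > 0, ∃ m q : ℝ, ∀ y : ℝ, |y - x| < ε → u y = m * y + q

/-- The admissible class `𝒜^{T,Λ,δ}`: continuous, `T`-periodic, piecewise affine functions
with slope in `{1, -Λ}` a.e., such that the region where the slope is `-Λ` is a union of
intervals of length `δ` whose pairwise intersections contain at most one point. -/
structure Admissible (T Λ δ : ℝ) (u : ℝ → ℝ) : Prop where
  cont : Continuous u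
  per : Function.Periodic u T
  pwAffine : PiecewiseAffine u
  slopes : ∀ᵐ x : ℝ ∂volume, HasDerivAt u 1 x ∨ HasDerivAt u (-Λ) x
  negRegion : ∃ a : ℕ → ℝ,
    (∀ k : ℕ, Set.Ioo (a k) (a k + δ) ⊆ {x : ℝ | HasDerivAt u (-Λ) x}) ∧
    ({x : ℝ | HasDerivAt u (-Λ) x} ⊆ ⋃ k : ℕ, Set.Icc (a k) (a k + δ)) ∧
    (Pairwise fun i j : ℕ =>
      (Set.Icc (a i) (a i + δ) ∩ Set.Icc (a j) (a j + δ)).Subsingleton)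

/-- The `s`-fractional Gagliardo seminorm energy density
`ℱ^T_s(u) = (1/(2T)) ∫_0^T ∫_ℝ |u(x)-u(y)|²/|x-y|^{1+2s} dy dx`. -/
def Fs (s T : ℝ) (u : ℝ → ℝ) : ℝ :=
  (1 / (2 * T)) * ∫ x in Set.Ioo (0 : ℝ) T, ∫ y : ℝ, (u x - u y) ^ 2 / |x - y| ^ (1 + 2 * s)

/-- The `s`-fractional Laplacian
`(-Δ)^s u (x) = 2 lim_{r→0⁺} ∫_{ℝ∖(x-r,x+r)} (u(x)-u(y))/|x-y|^{1+2s} dy`. -/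
def fracLap (s : ℝ) (u : ℝ → ℝ) (x : ℝ) : ℝ :=
  limUnder (𝓝[>] (0 : ℝ)) fun r : ℝ =>
    2 * ∫ y in {y : ℝ | r ≤ |x - y|}, (u x - u y) / |x - y| ^ (1 + 2 * s)

/-- The function `ū`: the `(Λ+1)δ`-periodic function equal to `-Λx` on `(-δ,0)` and to
`x` on `[0,Λδ]`. -/
def ubar (Λ δ : ℝ) (x : ℝ) : ℝ :=
  let y := ((Λ + 1) * δ) * Int.fract ((x + δ) / ((Λ + 1) * δ)) - δ
  if y < 0 then -Λ * y else y

/-- The extremal energy for `s = 0`: `ℱ^T_0(u) = (1/(2T)) ∫_0^T |u(x)|² dx`. -/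
def F0 (T : ℝ) (u : ℝ → ℝ) : ℝ :=
  (1 / (2 * T)) * ∫ x in Set.Ioo (0 : ℝ) T, (u x) ^ 2

/-- The extremal energy for `s = 1`: `ℱ^T_1(u) = (1/(2T)) ∫_0^T |u'(x)|² dx`. -/
def F1 (T : ℝ) (u : ℝ → ℝ) : ℝ :=
  (1 / (2 * T)) * ∫ x in Set.Ioo (0 : ℝ) T, (deriv u x) ^ 2

/-- The kernel `|h|^{-(1+2s)}` of the fractional seminorm. -/
def fracKernel (s h : ℝ) : ℝ := (|h| ^ (1 + 2 * s))⁻¹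

/-- The (negated) symmetric second difference of `u` at `x` with step `h`. -/
def secondDiff (u : ℝ → ℝ) (h x : ℝ) : ℝ := 2 * u x - u (x + h) - u (x - h)

lemma fracKernel_nonneg (s h : ℝ) : 0 ≤ fracKernel s h := by
  unfold fracKernel; positivity

lemma fracKernel_neg (s h : ℝ) : fracKernel s (-h) = fracKernel s h := by
  simp [fracKernel]

lemma measurable_fracKernel (s : ℝ) : Measurable (fracKernel s) := by
  unfold fracKernel
  fun_prop

lemma integrable_of_even {f : ℝ → ℝ} (hf : ∀ x, f (-x) = f x) (hi : IntegrableOn f (Ioi 0)) :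
    Integrable f := by
  have h2 : IntegrableOn f (Iio 0) := by simpa [hf] using hi.comp_neg
  rw [← integrableOn_univ, ← Iic_union_Ioi (a := (0 : ℝ))]
  exact ((integrableOn_Iic_iff_integrableOn_Iio).2 h2).union hi

lemma integrable_min_sq_mul_fracKernel {s : ℝ} (hs : 0 < s) (hs1 : s < 1) :
    Integrable (fun h => min (h ^ 2) 1 * fracKernel s h) := by
  refine integrable_of_even (fun h => by simp [fracKernel_neg]) ?_
  rw [← Ioc_union_Ioi_eq_Ioi (zero_le_one' ℝ)]
  refine IntegrableOn.union ?_ ?_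
  · have h1 := (intervalIntegral.intervalIntegrable_rpow' (a := 0) (b := 1)
      (r := 1 - 2 * s) (by linarith)).1
    refine h1.congr_fun (fun h hh => ?_) measurableSet_Ioc
    have h0 : 0 < h := hh.1
    have : min (h ^ 2) 1 = h ^ 2 := min_eq_left (by nlinarith [hh.2])
    simp only [fracKernel, this, abs_of_pos h0]
    rw [← Real.rpow_neg h0.le, ← Real.rpow_natCast h 2, ← Real.rpow_add h0]
    congr 1; push_cast; ring
  · have h1 := integrableOn_Ioi_rpow_of_lt (a := -(1 + 2 * s)) (c := 1) (by linarith) one_pos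
    refine h1.congr_fun (fun h hh => ?_) measurableSet_Ioi
    have h1 : 1 < h := hh
    have : min (h ^ 2) 1 = 1 := min_eq_right (by nlinarith)
    simp only [fracKernel, this, abs_of_pos (by linarith : 0 < h), one_mul]
    rw [Real.rpow_neg (by linarith)]

lemma exists_bound_of_continuous_periodic {v : ℝ → ℝ} {T : ℝ} (hT : 0 < T) (hc : Continuous v)
    (hp : Function.Periodic v T) : ∃ B, 0 ≤ B ∧ ∀ x, |v x| ≤ B := by
  obtain ⟨C, hC⟩ := isCompact_Icc.exists_bound_of_continuousOn (s := Icc 0 (0 + T)) hc.continuousOn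
  refine ⟨max C 0, le_max_right _ _, fun x => ?_⟩
  obtain ⟨y, hy, hxy⟩ := hp.exists_mem_Ico hT x 0
  rw [hxy]
  exact (hC y (Ico_subset_Icc_self hy)).trans (le_max_left _ _)

lemma sq_diff_le {v : ℝ → ℝ} {K B : ℝ} (hB : ∀ x, |v x| ≤ B)
    (hLip : ∀ x y, |v x - v y| ≤ K * |x - y|) (x h : ℝ) :
    (v (x + h) - v x) ^ 2 ≤ (K ^ 2 + 4 * B ^ 2) * min (h ^ 2) 1 := by
  have h1 : (v (x + h) - v x) ^ 2 ≤ K ^ 2 * h ^ 2 := by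
    have := hLip (x + h) x
    rw [add_sub_cancel_left] at this
    rw [← mul_pow, ← sq_abs]
    calc |v (x + h) - v x| ^ 2 ≤ (K * |h|) ^ 2 := by gcongr
      _ = (K * h) ^ 2 := by rw [mul_pow, sq_abs, mul_pow]
  have h2 : (v (x + h) - v x) ^ 2 ≤ 4 * B ^ 2 := by
    have := (abs_sub (v (x + h)) (v x)).trans (add_le_add (hB _) (hB _))
    rw [← sq_abs]
    calc |v (x + h) - v x| ^ 2 ≤ (B + B) ^ 2 := by gcongr
      _ = 4 * B ^ 2 := by ring
  rcases min_cases (h ^ 2) 1 with ⟨h3, _⟩ | ⟨h3, _⟩ <;> rw [h3] <;>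
    nlinarith [sq_nonneg K, sq_nonneg B, sq_nonneg h]

lemma Fs_eq {s T K : ℝ} (hs : 0 < s) (hs1 : s < 1) (hT : 0 < T) {v : ℝ → ℝ} (hc : Continuous v)
    (hp : Function.Periodic v T) (hLip : ∀ x y, |v x - v y| ≤ K * |x - y|) :
    Integrable (fun h => fracKernel s h * ∫ x in (0 : ℝ)..T, (v (x + h) - v x) ^ 2) ∧
    Fs s T v = 1 / (2 * T) * ∫ h, fracKernel s h * ∫ x in (0 : ℝ)..T, (v (x + h) - v x) ^ 2 := by
  obtain ⟨B, -, hB⟩ := exists_bound_of_continuous_periodic hT hc hp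
  have hint : Integrable (Function.uncurry fun x h => (v (x + h) - v x) ^ 2 * fracKernel s h)
      ((volume.restrict (Ioo 0 T)).prod volume) := by
    have h1 : Integrable (fun z : ℝ × ℝ => (K ^ 2 + 4 * B ^ 2) *
        (min (z.2 ^ 2) 1 * fracKernel s z.2)) ((volume.restrict (Ioo 0 T)).prod volume) :=
      Integrable.mul_prod (f := fun _ => K ^ 2 + 4 * B ^ 2) (integrable_const _)
        (integrable_min_sq_mul_fracKernel hs hs1)
    refine h1.mono' ?_ (Eventually.of_forall fun z => ?_)
    · have := measurable_fracKernel s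
      have := hc.measurable
      exact Measurable.aestronglyMeasurable (by unfold Function.uncurry; fun_prop)
    · have := sq_diff_le hB hLip z.1 z.2
      have h0 := fracKernel_nonneg s z.2
      simp only [Function.uncurry, Real.norm_eq_abs]
      rw [abs_of_nonneg (by positivity), ← mul_assoc]
      gcongr
  have hin : ∀ h, ∫ x in Ioo (0 : ℝ) T, (v (x + h) - v x) ^ 2 * fracKernel s h =
      fracKernel s h * ∫ x in (0 : ℝ)..T, (v (x + h) - v x) ^ 2 := fun h => by
    rw [integral_mul_const, intervalIntegral.integral_of_le hT.le, integral_Ioc_eq_integral_Ioo,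
      mul_comm]
  constructor
  · exact hint.integral_prod_right.congr (Eventually.of_forall hin)
  · rw [Fs, ← integral_congr_ae (Eventually.of_forall hin), ← integral_integral_swap hint]
    congr 2
    ext x
    rw [← integral_add_left_eq_self _ x]
    congr 1
    ext h
    simp only [fracKernel]
    rw [div_eq_mul_inv, sub_add_cancel_left, abs_neg, sub_sq_comm]

lemma integral_diff_mul_diff {w ψ : ℝ → ℝ} {T : ℝ} (hw : Continuous w) (hψ : Continuous ψ)
    (hwp : Function.Periodic w T) (hψp : Function.Periodic ψ T) (h : ℝ) :
    ∫ x in (0 : ℝ)..T, (w (x + h) - w x) * (ψ (x + h) - ψ x) =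
      ∫ x in (0 : ℝ)..T, ψ x * secondDiff w h x := by
  have key : ∫ x in (0 : ℝ)..T, ψ (x + h) * (w (x + h) - w x) =
      ∫ x in (0 : ℝ)..T, ψ x * (w x - w (x - h)) := by
    have hper : Function.Periodic (fun x => ψ x * (w x - w (x - h))) T := fun x => by
      simp only [hψp x, hwp x]
      rw [show x + T - h = (x - h) + T by ring, hwp]
    have := hper.intervalIntegral_add_eq 0 h
    rw [zero_add] at this
    rw [this, add_comm h T, ← zero_add h, ← add_assoc, add_zero,
      ← intervalIntegral.integral_comp_add_right]
    simp
  have e1 : ∀ x, (w (x + h) - w x) * (ψ (x + h) - ψ x) =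
      ψ (x + h) * (w (x + h) - w x) - ψ x * (w (x + h) - w x) := fun x => by ring
  have e2 : ∀ x, ψ x * secondDiff w h x =
      ψ x * (w x - w (x - h)) - ψ x * (w (x + h) - w x) := fun x => by
    unfold secondDiff; ring
  simp only [e1, e2]
  rw [intervalIntegral.integral_sub, intervalIntegral.integral_sub, key]
  all_goals exact Continuous.intervalIntegrable (by fun_prop) _ _

lemma Fs_add_sub {s T K K' : ℝ} (hs : 0 < s) (hs1 : s < 1) (hT : 0 < T) {u ψ : ℝ → ℝ}
    (hu : Continuous u) (hψ : Continuous ψ) (hup : Function.Periodic u T)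
    (hψp : Function.Periodic ψ T) (huLip : ∀ x y, |u x - u y| ≤ K * |x - y|)
    (hvLip : ∀ x y, |(u + ψ) x - (u + ψ) y| ≤ K' * |x - y|) (a : ℝ) :
    Fs s T (u + ψ) - Fs s T u = 1 / (2 * T) * ∫ h, fracKernel s h *
      ∫ x in a..a + T, ψ x * (2 * secondDiff u h x + secondDiff ψ h x) := by
  have hvp : Function.Periodic (u + ψ) T := hup.add hψp
  obtain ⟨i1, e1⟩ := Fs_eq hs hs1 hT (hu.add hψ) hvp hvLip
  obtain ⟨i2, e2⟩ := Fs_eq hs hs1 hT hu hup huLip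
  rw [e1, e2, ← mul_sub, ← integral_sub i1 i2]
  congr 2
  ext h
  rw [← mul_sub, ← intervalIntegral.integral_sub]
  rotate_left
  · exact Continuous.intervalIntegrable (by simp only [Pi.add_apply]; fun_prop) _ _
  · exact Continuous.intervalIntegrable (by fun_prop) _ _
  congr 1
  have hw : Continuous (fun x => 2 * u x + ψ x) := by fun_prop
  have hwp : Function.Periodic (fun x => 2 * u x + ψ x) T := fun x => by simp only [hup x, hψp x]
  have key := integral_diff_mul_diff hw hψ hwp hψp h
  have hper : Function.Periodic (fun x => ψ x * (2 * secondDiff u h x + secondDiff ψ h x)) T := by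
    intro x
    simp only [secondDiff]
    rw [show x + T + h = (x + h) + T by ring, show x + T - h = (x - h) + T by ring]
    simp only [hup _, hψp _]
  rw [hper.intervalIntegral_add_eq a 0, zero_add]
  convert key using 1
  · congr 1; ext x; simp only [Pi.add_apply]; ring
  · congr 1; ext x; simp only [secondDiff]; ring

/-- Near `x`, the function `u` is affine with slope `m` on the left and `n` on the right. -/
def HasKinkAt (u : ℝ → ℝ) (m n x : ℝ) : Prop :=
  ∀ᶠ y in 𝓝 x, u y = u x + m * min (y - x) 0 + n * max (y - x) 0

namespace HasKinkAt

variable {u v : ℝ → ℝ} {m n m' n' x : ℝ}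

lemma add (hu : HasKinkAt u m n x) (hv : HasKinkAt v m' n' x) :
    HasKinkAt (u + v) (m + m') (n + n') x := by
  filter_upwards [hu, hv] with y h1 h2
  simp only [Pi.add_apply, h1, h2]
  ring

lemma continuousAt (hu : HasKinkAt u m n x) : ContinuousAt u x := by
  have : ContinuousAt (fun y => u x + m * min (y - x) 0 + n * max (y - x) 0) x := by fun_prop
  exact this.congr (hu.mono fun y hy => hy.symm)

lemma hasDerivWithinAt_Ici (hu : HasKinkAt u m n x) : HasDerivWithinAt u n (Ici x) x := by
  have h1 : HasDerivWithinAt (fun y => u x + n * (y - x)) n (Ici x) x := by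
    simpa using (((hasDerivAt_id x).sub_const x).const_mul n |>.const_add (u x)).hasDerivWithinAt
  refine h1.congr_of_eventuallyEq ?_ (by simp)
  filter_upwards [nhdsWithin_le_nhds hu, self_mem_nhdsWithin] with y hy hxy
  have : 0 ≤ y - x := sub_nonneg.2 hxy
  rw [hy, min_eq_right this, max_eq_left this]
  ring

lemma hasDerivWithinAt_Iic (hu : HasKinkAt u m n x) : HasDerivWithinAt u m (Iic x) x := by
  have h1 : HasDerivWithinAt (fun y => u x + m * (y - x)) m (Iic x) x := by
    simpa using (((hasDerivAt_id x).sub_const x).const_mul m |>.const_add (u x)).hasDerivWithinAt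
  refine h1.congr_of_eventuallyEq ?_ (by simp)
  filter_upwards [nhdsWithin_le_nhds hu, self_mem_nhdsWithin] with y hy hxy
  have : y - x ≤ 0 := sub_nonpos.2 hxy
  rw [hy, min_eq_left this, max_eq_right this]
  ring

lemma hasDerivAt (hu : HasKinkAt u m m x) : HasDerivAt u m x := by
  have := hu.hasDerivWithinAt_Iic.union hu.hasDerivWithinAt_Ici
  rwa [Iic_union_Ici, hasDerivWithinAt_univ] at this

lemma eq_of_hasDerivAt {d : ℝ} (hu : HasKinkAt u m n x) (hd : HasDerivAt u d x) :
    m = d ∧ n = d :=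
  ⟨(uniqueDiffWithinAt_Iic x).eq_deriv _ hu.hasDerivWithinAt_Iic hd.hasDerivWithinAt,
    (uniqueDiffWithinAt_Ici x).eq_deriv _ hu.hasDerivWithinAt_Ici hd.hasDerivWithinAt⟩

lemma of_affine {q ε : ℝ} (hε : 0 < ε) (h : ∀ y, |y - x| < ε → u y = m * y + q) :
    HasKinkAt u m m x := by
  filter_upwards [Metric.ball_mem_nhds x hε] with y hy
  rw [h y hy, h x (by simpa using hε)]
  rcases le_total (y - x) 0 with h0 | h0 <;> simp only [min_eq_left, min_eq_right, max_eq_left,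
    max_eq_right, h0] <;> ring

lemma exists_pos (hu : HasKinkAt u m n x) : ∃ ε > 0,
    (∀ y ∈ Ioc (x - ε) x, u y = u x + m * (y - x)) ∧
    ∀ y ∈ Ico x (x + ε), u y = u x + n * (y - x) := by
  obtain ⟨ε, hε, h⟩ := Metric.eventually_nhds_iff.1 hu
  refine ⟨ε, hε, fun y hy => ?_, fun y hy => ?_⟩
  · have h0 : y - x ≤ 0 := by linarith [hy.2]
    rw [h (by rw [Real.dist_eq, abs_lt]; constructor <;> linarith [hy.1]), min_eq_left h0,
      max_eq_right h0]
    ring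
  · have h0 : 0 ≤ y - x := by linarith [hy.1]
    rw [h (by rw [Real.dist_eq, abs_lt]; constructor <;> linarith [hy.2]), min_eq_right h0,
      max_eq_left h0]
    ring

lemma of_pos {ε : ℝ} (hε : 0 < ε) (h1 : ∀ y ∈ Ioo (x - ε) x, u y = u x + m * (y - x))
    (h2 : ∀ y ∈ Ioo x (x + ε), u y = u x + n * (y - x)) : HasKinkAt u m n x := by
  filter_upwards [Ioo_mem_nhds (sub_lt_self x hε) (lt_add_of_pos_right x hε)] with y hy
  rcases lt_trichotomy y x with h | rfl | h
  · rw [h1 y ⟨hy.1, h⟩, min_eq_left (by linarith), max_eq_right (by linarith)]; ring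
  · simp
  · rw [h2 y ⟨h, hy.2⟩, min_eq_right (by linarith), max_eq_left (by linarith)]; ring

lemma of_mem_Ioo {p q c : ℝ} (h : ∀ y ∈ Ioo p q, u y = m * y + c) (hx : x ∈ Ioo p q) :
    HasKinkAt u m m x := by
  refine of_affine (q := c) (ε := min (x - p) (q - x))
    (lt_min (sub_pos.2 hx.1) (sub_pos.2 hx.2)) fun y hy => h y ?_
  obtain ⟨h1, h2⟩ := abs_lt.1 hy
  have := min_le_left (x - p) (q - x)
  have := min_le_right (x - p) (q - x)
  constructor <;> linarith

lemma comp_sub (hu : HasKinkAt u m n x) (c : ℝ) : HasKinkAt (fun y => u (y - c)) m n (x + c) := by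
  have h : Tendsto (fun y => y - c) (𝓝 (x + c)) (𝓝 x) := by
    have : ContinuousAt (fun y => y - c) (x + c) := by fun_prop
    simpa [ContinuousAt] using this
  filter_upwards [h.eventually hu] with y hy
  rw [hy, add_sub_cancel_right, show y - c - x = y - (x + c) by ring]

lemma add_zsmul {T : ℝ} (hp : Function.Periodic u T) (k : ℤ) (hu : HasKinkAt u m n x) :
    HasKinkAt u m n (x + k • T) := by
  have := hu.comp_sub (k • T)
  rwa [show (fun y => u (y - k • T)) = u from funext fun y => hp.sub_zsmul_eq k] at this

lemma congr (hu : HasKinkAt u m n x) (h : v =ᶠ[𝓝 x] u) : HasKinkAt v m n x := by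
  filter_upwards [hu, h] with y h1 h2
  rw [h2, h1, h.eq_of_nhds]

end HasKinkAt

lemma exists_affine_Ioo {u : ℝ → ℝ} {p q : ℝ}
    (h : ∀ x ∈ Ioo p q, ∃ ε > 0, ∃ m c : ℝ, ∀ y : ℝ, |y - x| < ε → u y = m * y + c) :
    ∃ m c, ∀ y ∈ Ioo p q, u y = m * y + c := by
  rcases le_or_gt q p with hpq | hpq
  · exact ⟨0, 0, fun y hy => absurd (hy.1.trans hy.2) hpq.not_gt⟩
  have hd : ∀ x ∈ Ioo p q, DifferentiableAt ℝ u x ∧ HasDerivAt (deriv u) 0 x := fun x hx => by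
    obtain ⟨ε, hε, m, c, hm⟩ := h x hx
    refine ⟨(HasKinkAt.of_affine hε hm).hasDerivAt.differentiableAt, ?_⟩
    refine (hasDerivAt_const x m).congr_of_eventuallyEq ?_
    filter_upwards [Metric.ball_mem_nhds x hε] with z hz
    refine (HasKinkAt.of_affine (q := c) (ε := ε - |z - x|) (sub_pos.2 hz)
      fun y hy => hm y ?_).hasDerivAt.deriv
    have := abs_sub_le y z x
    linarith
  have hz : (p + q) / 2 ∈ Ioo p q := ⟨by linarith, by linarith⟩
  set z := (p + q) / 2
  have h1 : ∀ y ∈ Ioo p q, deriv u y = deriv u z := fun y hy =>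
    isOpen_Ioo.is_const_of_deriv_eq_zero isPreconnected_Ioo
      (fun x hx => (hd x hx).2.differentiableAt.differentiableWithinAt)
      (fun x hx => (hd x hx).2.deriv) hy hz
  have h2 : ∀ x ∈ Ioo p q, HasDerivAt (fun y => u y - deriv u z * y) 0 x := fun x hx => by
    have := (hd x hx).1.hasDerivAt.fun_sub ((hasDerivAt_id x).const_mul (deriv u z))
    simpa [h1 x hx] using this
  refine ⟨deriv u z, u z - deriv u z * z, fun y hy => ?_⟩
  have := isOpen_Ioo.is_const_of_deriv_eq_zero isPreconnected_Ioo
      (fun x hx => (h2 x hx).differentiableAt.differentiableWithinAt)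
      (fun x hx => (h2 x hx).deriv) hy hz
  linarith

lemma eq_affine_of_closure {u : ℝ → ℝ} (hu : Continuous u) {p q m c : ℝ} (hpq : p < q)
    (h : ∀ y ∈ Ioo p q, u y = m * y + c) : ∀ y ∈ Icc p q, u y = m * y + c := by
  have h1 : EqOn u (fun y => m * y + c) (closure (Ioo p q)) :=
    EqOn.closure h hu (by fun_prop)
  rw [closure_Ioo hpq.ne] at h1
  exact h1

lemma PiecewiseAffine.exists_hasKinkAt {u : ℝ → ℝ} (hu : PiecewiseAffine u) (hc : Continuous u)
    (x : ℝ) : ∃ m n, HasKinkAt u m n x := by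
  obtain ⟨S, -, hiso, haff⟩ := hu
  by_cases hx : x ∈ S
  · obtain ⟨ε, hε, hS⟩ := hiso x hx
    obtain ⟨m, c, hm⟩ := exists_affine_Ioo (u := u) (p := x - ε) (q := x) fun y hy =>
      haff y fun hyS => hy.2.ne (hS ⟨hyS, hy.1, by linarith [hy.2]⟩)
    obtain ⟨n, d, hn⟩ := exists_affine_Ioo (u := u) (p := x) (q := x + ε) fun y hy =>
      haff y fun hyS => hy.1.ne' (hS ⟨hyS, by linarith [hy.1], hy.2⟩)
    have e1 := eq_affine_of_closure hc (by linarith) hm x ⟨by linarith, le_rfl⟩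
    have e2 := eq_affine_of_closure hc (by linarith) hn x ⟨le_rfl, by linarith⟩
    refine ⟨m, n, .of_pos hε (fun y hy => ?_) fun y hy => ?_⟩
    · rw [hm y hy, e1]; ring
    · rw [hn y hy, e2]; ring
  · obtain ⟨ε, hε, m, q, h⟩ := haff x hx
    exact ⟨m, m, .of_affine hε h⟩

lemma piecewiseAffine_of_hasKinkAt {u : ℝ → ℝ} (hu : ∀ x, ∃ m n, HasKinkAt u m n x) :
    PiecewiseAffine u := by
  refine ⟨{x | ∀ ε > 0, ∀ m q : ℝ, ∃ y : ℝ, |y - x| < ε ∧ u y ≠ m * y + q}, ?_, ?_, ?_⟩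
  · rw [← isOpen_compl_iff, Metric.isOpen_iff]
    intro x hx
    simp only [mem_compl_iff, mem_ofPred_eq] at hx
    push Not at hx
    obtain ⟨ε, hε, m, q, h⟩ := hx
    refine ⟨ε, hε, fun z hz hzS => ?_⟩
    obtain ⟨y, hy, hne⟩ := hzS (ε - |z - x|) (sub_pos.2 hz) m q
    refine hne (h y ?_)
    have := abs_sub_le y z x
    linarith
  · intro x _
    obtain ⟨m, n, h⟩ := hu x
    obtain ⟨ε, hε, h1, h2⟩ := h.exists_pos
    refine ⟨ε, hε, fun y hy => ?_⟩
    obtain ⟨hyS, hy1, hy2⟩ := hy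
    rcases lt_trichotomy y x with hyx | hyx | hyx
    · obtain ⟨z, hz, hne⟩ := hyS (min (y - (x - ε)) (x - y))
        (lt_min (by linarith) (by linarith)) m (u x - m * x)
      obtain ⟨hz1, hz2⟩ := lt_min_iff.1 hz
      rw [abs_lt] at hz1 hz2
      exact absurd (by rw [h1 z ⟨by linarith, by linarith⟩]; ring) hne
    · exact hyx
    · obtain ⟨z, hz, hne⟩ := hyS (min (y - x) (x + ε - y))
        (lt_min (by linarith) (by linarith)) n (u x - n * x)
      obtain ⟨hz1, hz2⟩ := lt_min_iff.1 hz
      rw [abs_lt] at hz1 hz2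
      exact absurd (by rw [h2 z ⟨by linarith, by linarith⟩]; ring) hne
  · intro x hx
    simp only [mem_ofPred_eq] at hx
    push Not at hx
    exact hx

lemma abs_sub_le_of_hasKinkAt {u : ℝ → ℝ} {K : ℝ}
    (hu : ∀ x, ∃ m n, |n| ≤ K ∧ HasKinkAt u m n x) (x y : ℝ) : |u x - u y| ≤ K * |x - y| := by
  choose m n hn h using hu
  have key : ∀ a b, a ≤ b → |u b - u a| ≤ K * (b - a) := fun a b hab =>
    norm_image_sub_le_of_norm_deriv_right_le_segment (f' := n)
      (fun z _ => (h z).continuousAt.continuousWithinAt)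
      (fun z _ => (h z).hasDerivWithinAt_Ici) (fun z _ => hn z) b ⟨hab, le_rfl⟩
  rcases le_total x y with hxy | hxy
  · rw [abs_sub_comm, abs_sub_comm x, abs_of_nonneg (sub_nonneg.2 hxy)]
    exact key x y hxy
  · rw [abs_of_nonneg (sub_nonneg.2 hxy)]
    exact key y x hxy

/-- `HasKinkAt` with both slopes in `{1, -Λ}`, the local form of an admissible function. -/
def HasAdmissibleKinks (Λ : ℝ) (u : ℝ → ℝ) : Prop :=
  ∀ x, ∃ m n, (m = 1 ∨ m = -Λ) ∧ (n = 1 ∨ n = -Λ) ∧ HasKinkAt u m n x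

lemma Admissible.hasAdmissibleKinks {T Λ δ : ℝ} {u : ℝ → ℝ} (hu : Admissible T Λ δ u) :
    HasAdmissibleKinks Λ u := by
  intro x
  have key : ∀ p q m c : ℝ, p < q → (∀ y ∈ Ioo p q, u y = m * y + c) → m = 1 ∨ m = -Λ := by
    intro p q m c hpq h
    obtain ⟨y, hy, hd⟩ := (isOpen_Ioo.measure_pos volume (nonempty_Ioo.2 hpq)).ne'
      |> (frequently_ae_mem_iff.2 ·) |>.and_eventually hu.slopes |>.exists
    have hk := HasKinkAt.of_mem_Ioo h hy
    exact hd.imp (fun h' => (hk.eq_of_hasDerivAt h').1) fun h' => (hk.eq_of_hasDerivAt h').1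
  obtain ⟨m, n, h⟩ := hu.pwAffine.exists_hasKinkAt hu.cont x
  obtain ⟨ε, hε, h1, h2⟩ := h.exists_pos
  refine ⟨m, n, key (x - ε) x m (u x - m * x) (by linarith) fun y hy => ?_,
    key x (x + ε) n (u x - n * x) (by linarith) fun y hy => ?_, h⟩
  · rw [h1 y ⟨hy.1, hy.2.le⟩]; ring
  · rw [h2 y ⟨hy.1.le, hy.2⟩]; ring

lemma HasAdmissibleKinks.abs_sub_le {Λ : ℝ} (hΛ : 0 < Λ) {u : ℝ → ℝ}
    (hu : HasAdmissibleKinks Λ u) (x y : ℝ) : |u x - u y| ≤ (1 + Λ) * |x - y| := by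
  refine abs_sub_le_of_hasKinkAt (fun x => ?_) x y
  obtain ⟨m, n, -, hn, h⟩ := hu x
  refine ⟨m, n, ?_, h⟩
  rcases hn with rfl | rfl
  · rw [abs_one]; linarith
  · rw [abs_neg, abs_of_pos hΛ]; linarith

lemma HasAdmissibleKinks.ae_slopes {Λ : ℝ} (hΛ : 0 < Λ) {u : ℝ → ℝ}
    (hu : HasAdmissibleKinks Λ u) : ∀ᵐ x : ℝ, HasDerivAt u 1 x ∨ HasDerivAt u (-Λ) x := by
  have hL : LipschitzWith (1 + Λ).toNNReal u := by
    refine LipschitzWith.of_dist_le_mul fun x y => ?_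
    rw [Real.coe_toNNReal _ (by linarith)]
    exact hu.abs_sub_le hΛ x y
  filter_upwards [hL.ae_differentiableAt_real] with x hx
  obtain ⟨m, n, hm, -, h⟩ := hu x
  have := (h.eq_of_hasDerivAt hx.hasDerivAt).1 ▸ hx.hasDerivAt
  rcases hm with rfl | rfl
  · exact .inl this
  · exact .inr this

lemma HasKinkAt.add_zsmul_iff {u : ℝ → ℝ} {m n x T : ℝ} (hp : Function.Periodic u T) (k : ℤ) :
    HasKinkAt u m n (x + k • T) ↔ HasKinkAt u m n x := by
  refine ⟨fun h => ?_, fun h => h.add_zsmul hp k⟩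
  have := h.add_zsmul hp (-k)
  rwa [neg_zsmul, add_neg_cancel_right] at this

lemma HasAdmissibleKinks.hasKinkAt_of_hasDerivAt {Λ d x : ℝ} {u : ℝ → ℝ}
    (hu : HasAdmissibleKinks Λ u) (hd : HasDerivAt u d x) : HasKinkAt u d d x := by
  obtain ⟨m, n, -, -, h⟩ := hu x
  obtain ⟨rfl, rfl⟩ := h.eq_of_hasDerivAt hd
  exact h

lemma eq_affine_of_hasDerivAt {u : ℝ → ℝ} (hu : Continuous u) {p q d : ℝ} (hpq : p < q)
    (h : ∀ y ∈ Ioo p q, HasDerivAt u d y) : ∀ y ∈ Icc p q, u y = u q + d * (y - q) := by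
  have hz : (p + q) / 2 ∈ Ioo p q := ⟨by linarith, by linarith⟩
  set z := (p + q) / 2
  have h2 : ∀ x ∈ Ioo p q, HasDerivAt (fun y => u y - d * y) 0 x := fun x hx => by
    have := (h x hx).fun_sub ((hasDerivAt_id x).const_mul d)
    simpa using this
  have h3 : ∀ y ∈ Ioo p q, u y = d * y + (u z - d * z) := fun y hy => by
    have := isOpen_Ioo.is_const_of_deriv_eq_zero isPreconnected_Ioo
        (fun x hx => (h2 x hx).differentiableAt.differentiableWithinAt)
        (fun x hx => (h2 x hx).deriv) hy hz
    linarith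
  have h4 := eq_affine_of_closure hu hpq h3
  intro y hy
  rw [h4 y hy, h4 q ⟨hpq.le, le_rfl⟩]
  ring

lemma subsingleton_Icc_inter_Icc_iff {δ : ℝ} (hδ : 0 < δ) (a b : ℝ) :
    (Icc a (a + δ) ∩ Icc b (b + δ)).Subsingleton ↔ δ ≤ |a - b| := by
  constructor
  · intro h
    by_contra! hlt
    obtain ⟨h1, h2⟩ := abs_lt.1 hlt
    rcases le_total a b with hab | hab
    · have := h (x := b) ⟨⟨hab, by linarith⟩, le_rfl, by linarith⟩ (y := a + δ)
        ⟨⟨by linarith, le_rfl⟩, by linarith, by linarith⟩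
      linarith
    · have := h (x := a) ⟨⟨le_rfl, by linarith⟩, hab, by linarith⟩ (y := b + δ)
        ⟨⟨by linarith, by linarith⟩, by linarith, le_rfl⟩
      linarith
  · rintro h x ⟨⟨h1, h2⟩, h3, h4⟩ y ⟨⟨h5, h6⟩, h7, h8⟩
    rcases le_abs.1 h with h | h <;> linarith

lemma HasAdmissibleKinks.hasKinkAt_of_min {Λ : ℝ} (hΛ : 0 < Λ) {u : ℝ → ℝ}
    (hu : HasAdmissibleKinks Λ u) {x₀ : ℝ} (hx₀ : ∀ x, u x₀ ≤ u x) : HasKinkAt u (-Λ) 1 x₀ := by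
  obtain ⟨m, n, hm, hn, h⟩ := hu x₀
  obtain ⟨ε, hε, h1, h2⟩ := h.exists_pos
  have e1 := h1 (x₀ - ε / 2) ⟨by linarith, by linarith⟩
  have e2 := h2 (x₀ + ε / 2) ⟨by linarith, by linarith⟩
  have l1 := hx₀ (x₀ - ε / 2)
  have l2 := hx₀ (x₀ + ε / 2)
  have hm' : m = -Λ := hm.resolve_left fun h => by subst h; linarith
  have hn' : n = 1 := hn.resolve_right fun h => by subst h; nlinarith
  rwa [hm', hn'] at h

lemma exists_interval_of_min {Λ δ : ℝ} (hΛ : 0 < Λ) (hδ : 0 < δ) {u : ℝ → ℝ}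
    (hu : HasAdmissibleKinks Λ u) {a : ℕ → ℝ}
    (ha1 : ∀ k, Ioo (a k) (a k + δ) ⊆ {x | HasDerivAt u (-Λ) x})
    (ha2 : {x | HasDerivAt u (-Λ) x} ⊆ ⋃ k, Icc (a k) (a k + δ))
    (ha3 : Pairwise fun i j => δ ≤ |a i - a j|) {x₀ : ℝ} (hx₀ : ∀ x, u x₀ ≤ u x) :
    ∃ k, a k + δ = x₀ := by
  obtain ⟨ε, hε, h1, h2⟩ := (hu.hasKinkAt_of_min hΛ hx₀).exists_pos
  have key : ∀ η, 0 < η → η < ε → ∃ k, x₀ - η ≤ a k + δ ∧ a k + δ ≤ x₀ := by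
    intro η hη hηε
    have hd : HasDerivAt u (-Λ) (x₀ - η) := (HasKinkAt.of_mem_Ioo (p := x₀ - ε) (q := x₀)
      (c := u x₀ + Λ * x₀) (fun y hy => by rw [h1 y ⟨hy.1, hy.2.le⟩]; ring)
      ⟨by linarith, by linarith⟩).hasDerivAt
    obtain ⟨k, hk⟩ := mem_iUnion.1 (ha2 hd)
    refine ⟨k, hk.2, ?_⟩
    by_contra! hlt
    obtain ⟨z, hz1, hz2⟩ := exists_between (lt_min hlt (lt_add_of_pos_right x₀ hε))
    obtain ⟨hz2, hz3⟩ := lt_min_iff.1 hz2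
    have hdz : HasDerivAt u (-Λ) z := ha1 k ⟨by linarith [hk.1], hz2⟩
    have hkz : HasKinkAt u 1 1 z := HasKinkAt.of_mem_Ioo (p := x₀) (q := x₀ + ε)
      (c := u x₀ - x₀) (fun y hy => by rw [h2 y ⟨hy.1.le, hy.2⟩]; ring) ⟨hz1, hz3⟩
    have := (hkz.eq_of_hasDerivAt hdz).1
    linarith
  have hm := min_le_left ε δ
  have hm' := min_le_right ε δ
  have hm0 : 0 < min ε δ := lt_min hε hδ
  obtain ⟨k, hk1, hk2⟩ := key (min ε δ / 2) (by linarith) (by linarith)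
  refine ⟨k, hk2.eq_or_lt.resolve_right fun hlt => ?_⟩
  have hq := min_le_left ε (x₀ - (a k + δ))
  have hq' := min_le_right ε (x₀ - (a k + δ))
  have hq0 : 0 < min ε (x₀ - (a k + δ)) := lt_min hε (by linarith)
  obtain ⟨j, hj1, hj2⟩ := key (min ε (x₀ - (a k + δ)) / 2) (by linarith) (by linarith)
  have hne : k ≠ j := by
    rintro rfl
    linarith
  rcases le_abs.1 (ha3 hne) with h | h <;> linarith

/-- A translate of the positive part. -/
def ramp (p x : ℝ) : ℝ := max (x - p) 0

/-- The trapezoidal bump with corners `a`, `a + t`, `b`, `b + t` and slopes `M`, `0`, `-M`. -/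
def trapezoid (M a b t x : ℝ) : ℝ := M * (ramp a x - ramp (a + t) x - ramp b x + ramp (b + t) x)

/-- The `T`-periodic extension of `trapezoid` from `[a, a + T)`. -/
def bump {T : ℝ} (hT : 0 < T) (M a b t x : ℝ) : ℝ := trapezoid M a b t (toIcoMod hT a x)

lemma hasKinkAt_ramp (p x : ℝ) :
    HasKinkAt (ramp p) (if p < x then 1 else 0) (if p ≤ x then 1 else 0) x := by
  rcases lt_trichotomy p x with h | rfl | h
  · rw [if_pos h, if_pos h.le]
    refine .of_mem_Ioo (p := p) (q := x + 1) (c := -p) (fun y hy => ?_) ⟨h, by linarith⟩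
    rw [ramp, max_eq_left (by linarith [hy.1])]; ring
  · rw [if_neg (lt_irrefl _), if_pos le_rfl]
    refine .of_pos one_pos (fun y hy => ?_) fun y hy => ?_
    · simp [ramp, hy.2.le]
    · simp [ramp, hy.1.le]
  · rw [if_neg h.not_gt, if_neg h.not_ge]
    refine .of_mem_Ioo (p := x - 1) (q := p) (c := 0) (fun y hy => ?_) ⟨by linarith, h⟩
    rw [ramp, max_eq_right (by linarith [hy.2])]; ring

lemma HasKinkAt.const_mul {u : ℝ → ℝ} {m n x : ℝ} (hu : HasKinkAt u m n x) (c : ℝ) :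
    HasKinkAt (fun y => c * u y) (c * m) (c * n) x := by
  filter_upwards [hu] with y h
  rw [h]; ring

lemma hasKinkAt_trapezoid (M a b t x : ℝ) : HasKinkAt (trapezoid M a b t)
    (M * ((if a < x then 1 else 0) - (if a + t < x then 1 else 0) - (if b < x then 1 else 0)
      + (if b + t < x then 1 else 0)))
    (M * ((if a ≤ x then 1 else 0) - (if a + t ≤ x then 1 else 0) - (if b ≤ x then 1 else 0)
      + (if b + t ≤ x then 1 else 0))) x := by
  have h := ((((hasKinkAt_ramp a x).add ((hasKinkAt_ramp (a + t) x).const_mul (-1))).add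
    ((hasKinkAt_ramp b x).const_mul (-1))).add (hasKinkAt_ramp (b + t) x)).const_mul M
  convert h using 1
  · ext y; simp only [trapezoid, Pi.add_apply]; ring
  · ring
  · ring

lemma trapezoid_eq_zero_of_le {M a b t x : ℝ} (hab : a ≤ b) (ht : 0 ≤ t) (hx : x ≤ a) :
    trapezoid M a b t x = 0 := by
  simp only [trapezoid, ramp]
  rw [max_eq_right (by linarith), max_eq_right (by linarith), max_eq_right (by linarith),
    max_eq_right (by linarith)]
  ring

lemma trapezoid_eq_zero_of_ge {M a b t x : ℝ} (hab : a ≤ b) (ht : 0 ≤ t) (hx : b + t ≤ x) :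
    trapezoid M a b t x = 0 := by
  simp only [trapezoid, ramp]
  rw [max_eq_left (by linarith), max_eq_left (by linarith), max_eq_left (by linarith),
    max_eq_left (by linarith)]
  ring

lemma trapezoid_eq_of_mem {M a b t x : ℝ} (hat : a + t ≤ x) (ht : 0 ≤ t) (hx : x ≤ b) :
    trapezoid M a b t x = M * t := by
  simp only [trapezoid, ramp]
  rw [max_eq_left (by linarith), max_eq_left (by linarith), max_eq_right (by linarith),
    max_eq_right (by linarith)]
  ring

lemma abs_trapezoid_le {M a b t x : ℝ} (hM : 0 ≤ M) (ht : 0 ≤ t) :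
    |trapezoid M a b t x| ≤ M * t := by
  have h : ∀ p, 0 ≤ ramp p x - ramp (p + t) x ∧ ramp p x - ramp (p + t) x ≤ t := fun p => by
    simp only [ramp]
    constructor
    · exact sub_nonneg.2 (max_le_max_right _ (by linarith))
    · rw [sub_le_iff_le_add]
      exact max_le (by linarith [le_max_left (x - (p + t)) 0])
        (by linarith [le_max_right (x - (p + t)) 0])
  rw [trapezoid, abs_mul, abs_of_nonneg hM]
  gcongr
  have := h a
  have := h b
  rw [abs_le]
  constructor <;> linarith

section bump

variable {T : ℝ} (hT : 0 < T) (M a b t : ℝ)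

lemma bump_periodic : Function.Periodic (bump hT M a b t) T := fun x => by
  simp only [bump, toIcoMod_add_right]

variable {a b t}

lemma abs_bump_le {M} (hM : 0 ≤ M) (ht : 0 ≤ t) (x : ℝ) : |bump hT M a b t x| ≤ M * t :=
  abs_trapezoid_le hM ht

lemma bump_eq_trapezoid (hab : a ≤ b) (ht : 0 ≤ t) {x : ℝ} (hx : x ∈ Ioo (b + t - T) (a + T)) :
    bump hT M a b t x = trapezoid M a b t x := by
  rw [bump]
  rcases le_or_gt a x with h | h
  · rw [(toIcoMod_eq_self hT).2 ⟨h, hx.2⟩]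
  · have : toIcoMod hT a x = x + T := by
      rw [← toIcoMod_add_right, toIcoMod_eq_self hT]
      exact ⟨by linarith [hx.1], by linarith⟩
    rw [this, trapezoid_eq_zero_of_le hab ht h.le,
      trapezoid_eq_zero_of_ge hab ht (by linarith [hx.1])]

lemma hasKinkAt_bump (hab : a ≤ b) (ht : 0 ≤ t) {x : ℝ} (hx : x ∈ Ioo (b + t - T) (a + T)) :
    HasKinkAt (bump hT M a b t)
    (M * ((if a < x then 1 else 0) - (if a + t < x then 1 else 0) - (if b < x then 1 else 0)
      + (if b + t < x then 1 else 0)))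
    (M * ((if a ≤ x then 1 else 0) - (if a + t ≤ x then 1 else 0) - (if b ≤ x then 1 else 0)
      + (if b + t ≤ x then 1 else 0))) x :=
  (hasKinkAt_trapezoid M a b t x).congr <|
    (eventually_of_mem (Ioo_mem_nhds hx.1 hx.2) fun _ hy => bump_eq_trapezoid hT M hab ht hy)

end bump

lemma exists_eq_toIco {T : ℝ} (hT : 0 < T) (a x : ℝ) :
    ∃ y ∈ Ico a (a + T), ∃ k : ℤ, x = y + k • T :=
  ⟨toIcoMod hT a x, toIcoMod_mem_Ico hT a x, toIcoDiv hT a x,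
    (toIcoMod_add_toIcoDiv_zsmul hT a x).symm⟩

section shift

variable {T Λ δ : ℝ} {u : ℝ → ℝ} {x₀ ε t : ℝ}

lemma hasKinkAt_add_bump_of_mem (hT : 0 < T) (hu : HasAdmissibleKinks Λ u)
    (hab : ∀ y ∈ Ioo (x₀ - δ) x₀, HasDerivAt u (-Λ) y) (hk : HasKinkAt u (-Λ) 1 x₀)
    (hb : ∀ y ∈ Ioo x₀ (x₀ + ε), HasKinkAt u 1 1 y) (ht : 0 < t) (htδ : t < δ) (htε : t < ε)
    (htT : δ + t < T) {x : ℝ} (hx : x ∈ Ioo (x₀ - δ + t) (x₀ + t)) :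
    HasKinkAt (u + bump hT (1 + Λ) (x₀ - δ) x₀ t) (-Λ) (-Λ) x := by
  have hψ := hasKinkAt_bump hT (1 + Λ) (a := x₀ - δ) (b := x₀) (t := t) (by linarith) ht.le
    (x := x) ⟨by linarith [hx.1], by linarith [hx.2]⟩
  have c1 : x₀ - δ < x := by linarith [hx.1]
  have c2 : x₀ - δ + t < x := hx.1
  have c4 : x < x₀ + t := hx.2
  simp only [if_pos c1, if_pos c2, if_pos c1.le, if_pos c2.le, if_neg c4.not_gt,
    if_neg c4.not_ge] at hψ
  rcases lt_trichotomy x x₀ with h | rfl | h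
  · convert (hu.hasKinkAt_of_hasDerivAt (hab x ⟨c1, h⟩)).add hψ using 1 <;>
      simp [h.not_gt, h.not_ge]
  · convert hk.add hψ using 1 <;> simp
  · convert (hb x ⟨h, by linarith⟩).add hψ using 1 <;> simp [h, h.le]

lemma hasKinkAt_add_bump_of_mem_Ico (hT : 0 < T) (hu : HasAdmissibleKinks Λ u)
    (huc : Continuous u)
    (hab : ∀ y ∈ Ioo (x₀ - δ) x₀, HasDerivAt u (-Λ) y) (ht : 0 < t) (htδ : t < δ)
    (htT : δ + t < T) {x : ℝ} (hx : x ∈ Ico (x₀ - δ) (x₀ - δ + t)) :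
    ∃ m, (m = 1 ∨ m = -Λ) ∧ HasKinkAt (u + bump hT (1 + Λ) (x₀ - δ) x₀ t) m 1 x := by
  have hψ := hasKinkAt_bump hT (1 + Λ) (a := x₀ - δ) (b := x₀) (t := t) (by linarith) ht.le
    (x := x) ⟨by linarith [hx.1], by linarith [hx.2]⟩
  have c2 : x < x₀ - δ + t := hx.2
  have c3 : x < x₀ := by linarith
  have c4 : x < x₀ + t := by linarith
  simp only [if_neg c2.not_gt, if_neg c2.not_ge, if_neg c3.not_gt, if_neg c3.not_ge,
    if_neg c4.not_gt, if_neg c4.not_ge, if_pos hx.1] at hψ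
  rcases hx.1.eq_or_lt with h | h
  · obtain ⟨m, n, hm, -, hmn⟩ := hu x
    have hn : n = -Λ := by
      obtain ⟨η, hη, -, h2⟩ := hmn.exists_pos
      have h3 := eq_affine_of_hasDerivAt huc (by linarith) hab
      have h4 := lt_min hη (by linarith : 0 < δ)
      have h5 := min_le_left η δ
      have h6 := min_le_right η δ
      set r := min η δ
      have e1 := h2 (x + r / 2) ⟨by linarith, by linarith⟩
      have e2 := h3 (x + r / 2) ⟨by linarith, by linarith⟩
      have e3 := h3 x ⟨by linarith, by linarith⟩
      rw [e2, e3] at e1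
      have : (n + Λ) * r = 0 := by linarith
      rcases mul_eq_zero.1 this with h | h <;> linarith
    subst hn
    refine ⟨m, hm, ?_⟩
    convert hmn.add hψ using 1
    · simp [h]
    · ring
  · refine ⟨1, .inl rfl, ?_⟩
    convert (hu.hasKinkAt_of_hasDerivAt (hab x ⟨h, c3⟩)).add hψ using 1
    · simp [h]
    · ring

lemma hasKinkAt_add_bump_of_gt (hT : 0 < T) (hδ : 0 < δ) (ht : 0 < t) {m n x : ℝ}
    (hx : x ∈ Ioo (x₀ + t) (x₀ - δ + T)) (h : HasKinkAt u m n x) :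
    HasKinkAt (u + bump hT (1 + Λ) (x₀ - δ) x₀ t) m n x := by
  refine h.congr (eventually_of_mem (Ioo_mem_nhds hx.1 hx.2) fun y hy => ?_)
  rw [Pi.add_apply, bump_eq_trapezoid hT _ (by linarith) ht.le ⟨by linarith [hy.1, hx.2], hy.2⟩,
    trapezoid_eq_zero_of_ge (by linarith) ht.le hy.1.le, add_zero]

lemma hasAdmissibleKinks_add_bump (hT : 0 < T) (hδ : 0 < δ) (hu : HasAdmissibleKinks Λ u)
    (huc : Continuous u) (hup : Function.Periodic u T)
    (hab : ∀ y ∈ Ioo (x₀ - δ) x₀, HasDerivAt u (-Λ) y) (hk : HasKinkAt u (-Λ) 1 x₀)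
    (hb : ∀ y ∈ Ioo x₀ (x₀ + ε), HasKinkAt u 1 1 y) (ht : 0 < t) (htδ : t < δ) (htε : t < ε)
    (htT : δ + t < T) : HasAdmissibleKinks Λ (u + bump hT (1 + Λ) (x₀ - δ) x₀ t) := by
  intro x
  obtain ⟨y, hy, k, rfl⟩ := exists_eq_toIco hT (x₀ - δ) x
  simp only [HasKinkAt.add_zsmul_iff (hup.add (bump_periodic hT _ _ _ _))]
  rcases lt_or_ge y (x₀ - δ + t) with h1 | h1
  · obtain ⟨m, hm, h⟩ := hasKinkAt_add_bump_of_mem_Ico hT hu huc hab ht htδ htT ⟨hy.1, h1⟩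
    exact ⟨m, 1, hm, .inl rfl, h⟩
  have hψ := hasKinkAt_bump hT (1 + Λ) (a := x₀ - δ) (b := x₀) (t := t) (by linarith) ht.le
    (x := y) ⟨by linarith, hy.2⟩
  rcases h1.eq_or_lt with h1 | h1
  · refine ⟨1, -Λ, .inl rfl, .inr rfl, ?_⟩
    have c1 : x₀ - δ < y := by linarith
    have c3 : y < x₀ := by linarith
    have c4 : y < x₀ + t := by linarith
    convert (hu.hasKinkAt_of_hasDerivAt (hab y ⟨c1, c3⟩)).add hψ using 1
    · simp [c1, h1, c3.not_gt, c4.not_gt]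
    · simp [c1.le, h1, c3.not_ge, c4.not_ge]
  rcases lt_trichotomy y (x₀ + t) with h2 | h2 | h2
  · exact ⟨-Λ, -Λ, .inr rfl, .inr rfl,
      hasKinkAt_add_bump_of_mem hT hu hab hk hb ht htδ htε htT ⟨h1, h2⟩⟩
  · refine ⟨-Λ, 1, .inr rfl, .inl rfl, ?_⟩
    have c1 : x₀ - δ < y := by linarith
    have c3 : x₀ < y := by linarith
    convert (hb y ⟨c3, by linarith⟩).add hψ using 1
    · simp [c1, h1, c3, h2.not_gt]
    · simp [c1.le, h1.le, c3.le, h2.ge]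
  · obtain ⟨m, n, hm, hn, h⟩ := hu y
    exact ⟨m, n, hm, hn, hasKinkAt_add_bump_of_gt hT hδ ht ⟨h2, hy.2⟩ h⟩

lemma admissible_add_bump (hT : 0 < T) (hΛ : 0 < Λ) (hδ : 0 < δ) (hu : Admissible T Λ δ u)
    (hx₀ : ∀ x, u x₀ ≤ u x) (hab : ∀ y ∈ Ioo (x₀ - δ) x₀, HasDerivAt u (-Λ) y)
    (hb : ∀ y ∈ Ioo x₀ (x₀ + ε), HasKinkAt u 1 1 y) (ht : 0 < t) (htδ : t < δ) (htε : t < ε)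
    (htT : δ + t < T) : Admissible T Λ δ (u + bump hT (1 + Λ) (x₀ - δ) x₀ t) := by
  classical
  have huk := hu.hasAdmissibleKinks
  have hk := huk.hasKinkAt_of_min hΛ hx₀
  have hv := hasAdmissibleKinks_add_bump hT hδ huk hu.cont hu.per hab hk hb ht htδ htε htT
  have hvp : Function.Periodic (u + bump hT (1 + Λ) (x₀ - δ) x₀ t) T :=
    hu.per.add (bump_periodic hT _ _ _ _)
  refine ⟨?_, hvp, ?_, hv.ae_slopes hΛ, ?_⟩
  · refine continuous_iff_continuousAt.2 fun x => ?_
    obtain ⟨m, n, -, -, h⟩ := hv x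
    exact h.continuousAt
  · refine piecewiseAffine_of_hasKinkAt fun x => ?_
    obtain ⟨m, n, -, -, h⟩ := hv x
    exact ⟨m, n, h⟩
  obtain ⟨a, ha1, ha2, ha3⟩ := hu.negRegion
  simp only [subsingleton_Icc_inter_Icc_iff hδ] at ha3
  have hex : ∀ n : ℤ, ∃ k, a k + δ = x₀ + n • T := fun n =>
    exists_interval_of_min hΛ hδ huk ha1 ha2 ha3 fun x => by
      rw [hu.per.zsmul n]; exact hx₀ x
  have hsep : ∀ k, (¬ ∃ n : ℤ, a k + δ = x₀ + n • T) → ∀ n : ℤ,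
      a k ≤ x₀ - δ + n • T - δ ∨ x₀ + t + n • T ≤ a k := by
    intro k hk n
    obtain ⟨j, hj⟩ := hex n
    have hne : k ≠ j := by
      rintro rfl
      exact hk ⟨n, hj⟩
    rcases le_abs.1 (ha3 hne) with h | h
    · right
      by_contra! hlt
      obtain ⟨z, hz1, hz2⟩ := exists_between
        (lt_min (lt_add_of_pos_right (a k) hδ) (by linarith : a k < x₀ + ε + n • T))
      obtain ⟨hz2, hz3⟩ := lt_min_iff.1 hz2
      have hd : HasDerivAt u (-Λ) z := ha1 k ⟨hz1, hz2⟩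
      have hkz := (hb (z - n • T) ⟨by linarith, by linarith⟩).add_zsmul hu.per n
      rw [sub_add_cancel] at hkz
      have := (hkz.eq_of_hasDerivAt hd).1
      linarith
    · left; linarith
  refine ⟨fun k => if ∃ n : ℤ, a k + δ = x₀ + n • T then a k + t else a k, ?_, ?_, ?_⟩
  · intro k x hx
    beta_reduce at hx
    split_ifs at hx with hkn
    · obtain ⟨n, hn⟩ := hkn
      have := (hasKinkAt_add_bump_of_mem hT huk hab hk hb ht htδ htε htT (x := x - n • T)
        ⟨by linarith [hx.1], by linarith [hx.2]⟩).add_zsmul hvp n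
      rw [sub_add_cancel] at this
      exact this.hasDerivAt
    · obtain ⟨y, hy, n, rfl⟩ := exists_eq_toIco hT (x₀ - δ) x
      have h1 := (hsep k hkn n).resolve_left fun h => by linarith [hy.1, hx.2]
      have h2 := huk.hasKinkAt_of_hasDerivAt (ha1 k hx)
      rw [HasKinkAt.add_zsmul_iff hu.per] at h2
      exact ((hasKinkAt_add_bump_of_gt hT hδ ht ⟨by linarith [hx.1], hy.2⟩ h2).add_zsmul
        hvp n).hasDerivAt
  · intro x hx
    have hkx := hv.hasKinkAt_of_hasDerivAt hx
    obtain ⟨y, hy, n, rfl⟩ := exists_eq_toIco hT (x₀ - δ) x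
    rw [HasKinkAt.add_zsmul_iff hvp] at hkx
    rcases lt_or_ge y (x₀ - δ + t) with h1 | h1
    · obtain ⟨m, -, h⟩ := hasKinkAt_add_bump_of_mem_Ico hT huk hu.cont hab ht htδ htT
        ⟨hy.1, h1⟩
      have := (h.eq_of_hasDerivAt hkx.hasDerivAt).2
      linarith
    rcases le_or_gt y (x₀ + t) with h2 | h2
    · obtain ⟨k, hk⟩ := hex n
      refine mem_iUnion.2 ⟨k, ?_⟩
      simp only
      rw [if_pos ⟨n, hk⟩]
      constructor <;> linarith
    · obtain ⟨p, q, -, -, h⟩ := huk y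
      obtain ⟨rfl, rfl⟩ := (hasKinkAt_add_bump_of_gt hT hδ ht ⟨h2, hy.2⟩ h).eq_of_hasDerivAt
        hkx.hasDerivAt
      obtain ⟨k, hk⟩ := mem_iUnion.1 (ha2 (h.add_zsmul hu.per n).hasDerivAt)
      refine mem_iUnion.2 ⟨k, ?_⟩
      simp only
      rwa [if_neg]
      rintro ⟨m, hm⟩
      simp only [zsmul_eq_mul] at hm hk
      rcases le_or_gt m n with hmn | hmn
      · have : (m : ℝ) * T ≤ n * T := by gcongr
        linarith [hk.2]
      · have : ((n : ℝ) + 1) * T ≤ m * T := by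
          gcongr
          exact_mod_cast hmn
        linarith [hk.1, hy.2]
  · intro i j hij
    simp only [subsingleton_Icc_inter_Icc_iff hδ]
    split_ifs with hi hj hj
    · simpa using ha3 hij
    · obtain ⟨n, hn⟩ := hi
      rcases hsep j hj n with h | h
      · exact le_abs.2 (.inl (by linarith))
      · exact le_abs.2 (.inr (by linarith))
    · obtain ⟨n, hn⟩ := hj
      rcases hsep i hi n with h | h
      · exact le_abs.2 (.inr (by linarith))
      · exact le_abs.2 (.inl (by linarith))
    · exact ha3 hij

end shift

lemma abs_secondDiff_le {w : ℝ → ℝ} {B : ℝ} (hB : ∀ x, |w x| ≤ B) (h x : ℝ) :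
    |secondDiff w h x| ≤ 4 * B := by
  have h1 := abs_le.1 (hB x)
  have h2 := abs_le.1 (hB (x + h))
  have h3 := abs_le.1 (hB (x - h))
  rw [secondDiff, abs_le]
  constructor <;> linarith

lemma continuous_secondDiff {w : ℝ → ℝ} (hw : Continuous w) :
    Continuous (fun z : ℝ × ℝ => secondDiff w z.1 z.2) := by
  unfold secondDiff; fun_prop

lemma abs_secondDiff_ramp_le (p h x : ℝ) :
    |secondDiff (ramp p) h x| ≤ (Icc (p - |h|) (p + |h|)).indicator (fun _ => |h|) x := by
  by_cases hx : x ∈ Icc (p - |h|) (p + |h|)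
  · rw [indicator_of_mem hx]
    obtain ⟨h1, h2⟩ := hx
    simp only [secondDiff, ramp]
    rcases abs_cases h with ⟨e, _⟩ | ⟨e, _⟩ <;> rw [e] at * <;>
    rcases max_cases (x - p) 0 with ⟨e1, _⟩ | ⟨e1, _⟩ <;> rw [e1] <;>
    rcases max_cases (x + h - p) 0 with ⟨e2, _⟩ | ⟨e2, _⟩ <;> rw [e2] <;>
    rcases max_cases (x - h - p) 0 with ⟨e3, _⟩ | ⟨e3, _⟩ <;> rw [e3, abs_le] <;>
    constructor <;> linarith
  · rw [indicator_of_notMem hx]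
    have h1 := le_abs_self h
    have h2 := neg_abs_le h
    simp only [mem_Icc, not_and_or, not_le] at hx
    simp only [secondDiff, ramp]
    rcases hx with hx | hx
    · rw [max_eq_right (by linarith), max_eq_right (by linarith), max_eq_right (by linarith)]
      simp
    · rw [max_eq_left (by linarith), max_eq_left (by linarith), max_eq_left (by linarith)]
      ring_nf; simp

lemma integral_abs_secondDiff_le {ι : Type*} [Fintype ι] {w : ℝ → ℝ} (hw : Continuous w)
    {α β lo hi a b h : ℝ} (κ p : ι → ℝ)
    (hform : ∀ y ∈ Ioo lo hi, w y = β + α * y + ∑ i, κ i * ramp (p i) y)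
    (hab : a ≤ b) (hlo : lo < a - |h|) (hhi : b + |h| < hi) :
    ∫ x in a..b, |secondDiff w h x| ≤ (∑ i, |κ i|) * (2 * h ^ 2) := by
  have hpt : ∀ x ∈ Icc a b, |secondDiff w h x| ≤
      ∑ i, |κ i| * (Icc (p i - |h|) (p i + |h|)).indicator (fun _ => |h|) x := by
    intro x hx
    have h1 := le_abs_self h
    have h2 := neg_abs_le h
    have e : secondDiff w h x = ∑ i, κ i * secondDiff (ramp (p i)) h x := by
      rw [secondDiff, hform x ⟨by linarith [hx.1, abs_nonneg h], by linarith [hx.2, abs_nonneg h]⟩,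
        hform (x + h) ⟨by linarith [hx.1], by linarith [hx.2]⟩,
        hform (x - h) ⟨by linarith [hx.1], by linarith [hx.2]⟩]
      simp only [secondDiff, mul_sub, Finset.sum_sub_distrib, mul_left_comm _ (2 : ℝ),
        ← Finset.mul_sum]
      ring
    rw [e]
    refine (Finset.abs_sum_le_sum_abs _ _).trans (Finset.sum_le_sum fun i _ => ?_)
    rw [abs_mul]
    gcongr
    exact abs_secondDiff_ramp_le _ _ _
  have hint : ∀ q, Integrable ((Icc (q - |h|) (q + |h|)).indicator (fun _ => |h|)) := fun q =>
    (integrable_indicator_iff measurableSet_Icc).2 (integrableOn_const (by simp))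
  have hsum : Integrable fun x => ∑ i, |κ i| *
      (Icc (p i - |h|) (p i + |h|)).indicator (fun _ => |h|) x :=
    integrable_finsetSum _ fun i _ => (hint _).const_mul _
  calc ∫ x in a..b, |secondDiff w h x|
      ≤ ∫ x in a..b, ∑ i, |κ i| * (Icc (p i - |h|) (p i + |h|)).indicator (fun _ => |h|) x := by
        refine intervalIntegral.integral_mono_on hab ?_ hsum.intervalIntegrable hpt
        exact Continuous.intervalIntegrable (by unfold secondDiff; fun_prop) _ _
    _ ≤ ∫ x, ∑ i, |κ i| * (Icc (p i - |h|) (p i + |h|)).indicator (fun _ => |h|) x := by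
        rw [intervalIntegral.integral_of_le hab]
        refine setIntegral_le_integral hsum (Eventually.of_forall fun x => ?_)
        exact Finset.sum_nonneg fun i _ => mul_nonneg (abs_nonneg _)
          (indicator_nonneg (fun _ _ => abs_nonneg h) _)
    _ = (∑ i, |κ i|) * (2 * h ^ 2) := by
        rw [integral_finsetSum _ fun i _ => (hint _).const_mul _, Finset.sum_mul]
        refine Finset.sum_congr rfl fun i _ => ?_
        rw [integral_const_mul, integral_indicator measurableSet_Icc, setIntegral_const,
          Real.volume_real_Icc_of_le (by linarith [abs_nonneg h]), smul_eq_mul, ← sq_abs h]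
        ring

lemma le_mul_min_sq {f : ℝ → ℝ} {C₁ C₂ r : ℝ} (hC₁ : 0 ≤ C₁) (hC₂ : 0 ≤ C₂) (hr : 0 < r)
    (hr1 : r ≤ 1) (h1 : ∀ h, |h| < r → f h ≤ C₁ * h ^ 2) (h2 : ∀ h, f h ≤ C₂) (h : ℝ) :
    f h ≤ (C₁ + C₂ / r ^ 2) * min (h ^ 2) 1 := by
  have hC : 0 ≤ C₂ / r ^ 2 := by positivity
  rcases lt_or_ge |h| r with hh | hh
  · have : h ^ 2 ≤ 1 := by rw [← sq_abs]; nlinarith [abs_nonneg h]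
    rw [min_eq_left this]
    nlinarith [h1 h hh, sq_nonneg h]
  · have hr2 : r ^ 2 ≤ min (h ^ 2) 1 := le_min (by rw [← sq_abs h]; gcongr) (by nlinarith)
    calc f h ≤ C₂ := h2 h
      _ = C₂ / r ^ 2 * r ^ 2 := by field_simp
      _ ≤ C₂ / r ^ 2 * min (h ^ 2) 1 := by gcongr
      _ ≤ (C₁ + C₂ / r ^ 2) * min (h ^ 2) 1 := by
        have : 0 ≤ min (h ^ 2) 1 := by positivity
        nlinarith

lemma fracLap_eq_integral_secondDiff {s : ℝ} (hs : 0 < s) (hs1 : s < 1) {u : ℝ → ℝ}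
    (hu : Continuous u) {B : ℝ} (hB : ∀ x, |u x| ≤ B) {x η : ℝ} (hη : 0 < η)
    (h0 : ∀ h, |h| < η → secondDiff u h x = 0) :
    fracLap s u x = ∫ h, secondDiff u h x * fracKernel s h := by
  refine Tendsto.limUnder_eq (tendsto_nhds_of_eventually_eq ?_)
  filter_upwards [Ioo_mem_nhdsGT hη] with r hr
  set g : ℝ → ℝ := {h : ℝ | r ≤ |h|}.indicator fun h => (u x - u (x + h)) * fracKernel s h with hg
  have hmeas : MeasurableSet {h : ℝ | r ≤ |h|} :=
    (isClosed_le continuous_const continuous_abs).measurableSet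
  have hgi : Integrable g := by
    have hr0 : 0 < min (r ^ 2) 1 := lt_min (pow_pos hr.1 2) one_pos
    refine ((integrable_min_sq_mul_fracKernel hs hs1).const_mul
      (2 * B / min (r ^ 2) 1)).mono' ?_ (Eventually.of_forall fun h => ?_)
    · have := measurable_fracKernel s
      have := hu.measurable
      exact (Measurable.indicator (by fun_prop) hmeas).aestronglyMeasurable
    · have hk := fracKernel_nonneg s h
      have hB0 : 0 ≤ B := (abs_nonneg _).trans (hB 0)
      by_cases hh : h ∈ {h : ℝ | r ≤ |h|}
      · rw [hg, indicator_of_mem hh, Real.norm_eq_abs, abs_mul, abs_of_nonneg hk, ← mul_assoc]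
        gcongr
        have hrh : min (r ^ 2) 1 ≤ min (h ^ 2) 1 := by
          refine min_le_min_right _ ?_
          rw [← sq_abs h]
          exact pow_le_pow_left₀ hr.1.le hh 2
        calc |u x - u (x + h)| ≤ |u x| + |u (x + h)| := abs_sub _ _
          _ ≤ 2 * B := by linarith [hB x, hB (x + h)]
          _ = 2 * B / min (r ^ 2) 1 * min (r ^ 2) 1 := by field_simp
          _ ≤ _ := by gcongr
      · rw [hg, indicator_of_notMem hh, norm_zero]
        positivity
  have e1 : ∫ y in {y : ℝ | r ≤ |x - y|}, (u x - u y) / |x - y| ^ (1 + 2 * s) = ∫ h, g h := by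
    rw [← integral_indicator
      (isClosed_le continuous_const (by fun_prop : Continuous fun y => |x - y|)).measurableSet,
      ← integral_add_left_eq_self _ x]
    congr 1
    ext h
    simp only [hg, indicator_apply, mem_ofPred_eq, sub_add_cancel_left, abs_neg, fracKernel,
      div_eq_mul_inv]
  rw [e1, two_mul]
  nth_rw 2 [← integral_neg_eq_self]
  rw [← integral_add hgi hgi.comp_neg]
  congr 1
  ext h
  simp only [hg, indicator_apply, mem_ofPred_eq, abs_neg, fracKernel_neg]
  split_ifs with hh
  · simp only [secondDiff, ← sub_eq_add_neg]; ring
  · rw [h0 h (by linarith [hr.2])]; simp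

section limit

variable {s M B τ A b E : ℝ} {u : ℝ → ℝ} {ψ : ℝ → ℝ → ℝ}

lemma tendsto_integral_mul_secondDiff (hu : Continuous u) (hB : ∀ x, |u x| ≤ B) (hM : 0 ≤ M)
    (hAb : A < b) (hbE : b < E) (hτ : 0 < τ) (hψ : ∀ t ∈ Ioo 0 τ, Continuous (ψ t))
    (hψM : ∀ t ∈ Ioo 0 τ, ∀ x, |ψ t x| ≤ M * t)
    (hψ1 : ∀ t ∈ Ioo 0 τ, ∀ x ∈ Icc (A + t) b, ψ t x = M * t)
    (hψ0 : ∀ t ∈ Ioo 0 τ, ∀ x ∈ Icc (b + t) E, ψ t x = 0) (h : ℝ) :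
    Tendsto (fun t => ∫ x in A..E, t⁻¹ * (ψ t x * (2 * secondDiff u h x + secondDiff (ψ t) h x)))
      (𝓝[>] 0) (𝓝 (∫ x in A..b, 2 * M * secondDiff u h x)) := by
  rw [← intervalIntegral.integral_indicator ⟨hAb.le, hbE.le⟩]
  have hB0 : 0 ≤ B := (abs_nonneg _).trans (hB 0)
  have hτ' : ∀ᶠ t in 𝓝[>] (0 : ℝ), t ∈ Ioo 0 τ := Ioo_mem_nhdsGT hτ
  refine intervalIntegral.tendsto_integral_filter_of_dominated_convergence
    (fun _ => M * (2 * (4 * B) + 4 * (M * τ))) ?_ ?_ intervalIntegrable_const ?_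
  · filter_upwards [hτ'] with t ht
    have := hψ t ht
    exact Continuous.aestronglyMeasurable (by unfold secondDiff; fun_prop)
  · filter_upwards [hτ'] with t ht
    refine Eventually.of_forall fun x _ => ?_
    have ht0 : 0 < t := ht.1
    have h1 := abs_secondDiff_le hB h x
    have h2 := abs_secondDiff_le (hψM t ht) h x
    rw [← mul_assoc, Real.norm_eq_abs, abs_mul, abs_mul, abs_of_pos (inv_pos.2 ht0)]
    have h3 : t⁻¹ * |ψ t x| ≤ M := by
      rw [inv_mul_le_iff₀ ht0, mul_comm]
      exact hψM t ht x
    have h4 : M * t ≤ M * τ := by gcongr; exact ht.2.le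
    gcongr
    refine (abs_add_le _ _).trans ?_
    rw [abs_mul, abs_two]
    linarith
  · refine Eventually.of_forall fun x hx => ?_
    rw [uIoc_of_le (by linarith)] at hx
    have hD : Tendsto (fun t => 2 * secondDiff u h x + secondDiff (ψ t) h x) (𝓝[>] 0)
        (𝓝 (2 * secondDiff u h x)) := by
      have : Tendsto (fun t => secondDiff (ψ t) h x) (𝓝[>] 0) (𝓝 0) := by
        refine squeeze_zero_norm' (a := fun t => 4 * (M * t)) ?_ ?_
        · filter_upwards [hτ'] with t ht
          exact abs_secondDiff_le (hψM t ht) h x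
        · refine (Continuous.tendsto' (by fun_prop) 0 0 (by simp)).mono_left nhdsWithin_le_nhds
      simpa using this.const_add (2 * secondDiff u h x)
    rcases le_or_gt x b with hxb | hxb
    · rw [indicator_of_mem (by exact hxb)]
      have := hD.const_mul M
      rw [← mul_assoc, mul_comm M] at this
      refine this.congr' ?_
      filter_upwards [hτ', Ioo_mem_nhdsGT (sub_pos.2 hx.1)] with t ht ht'
      have := ht.1.ne'
      rw [hψ1 t ht x ⟨by linarith [ht'.2], hxb⟩]
      field_simp
    · rw [indicator_of_notMem (by simpa using hxb)]
      refine tendsto_const_nhds.congr' ?_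
      filter_upwards [hτ', Ioo_mem_nhdsGT (sub_pos.2 hxb)] with t ht ht'
      rw [hψ0 t ht x ⟨by linarith [ht'.2], hx.2⟩]
      simp

lemma abs_integral_mul_secondDiff_le {R C h t : ℝ} (hu : Continuous u) (hM : 0 ≤ M)
    (hAR : A ≤ R) (hRE : R ≤ E) (ht : 0 < t) (hψ : Continuous (ψ t))
    (hψM : ∀ x, |ψ t x| ≤ M * t) (hψ0 : ∀ x ∈ Icc R E, ψ t x = 0)
    (hC : ∫ x in A..R, |secondDiff u h x| ≤ C)
    {C' : ℝ} (hC' : ∫ x in A..R, |secondDiff (ψ t) h x| ≤ C') :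
    |∫ x in A..E, t⁻¹ * (ψ t x * (2 * secondDiff u h x + secondDiff (ψ t) h x))| ≤
      M * (2 * C + C') := by
  have cu : Continuous (secondDiff u h) := by unfold secondDiff; fun_prop
  have cψ : Continuous (secondDiff (ψ t) h) := by unfold secondDiff; fun_prop
  have e : ∫ x in A..E, t⁻¹ * (ψ t x * (2 * secondDiff u h x + secondDiff (ψ t) h x)) =
      ∫ x in A..R, t⁻¹ * (ψ t x * (2 * secondDiff u h x + secondDiff (ψ t) h x)) := by
    rw [← intervalIntegral.integral_add_adjacent_intervals (b := R)
      (Continuous.intervalIntegrable (by fun_prop) _ _)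
      (Continuous.intervalIntegrable (by fun_prop) _ _), add_eq_left,
      intervalIntegral.integral_of_le hRE]
    refine setIntegral_eq_zero_of_forall_eq_zero fun x hx => ?_
    rw [hψ0 x ⟨hx.1.le, hx.2⟩]; simp
  rw [e]
  calc _ ≤ ∫ x in A..R, |t⁻¹ * (ψ t x * (2 * secondDiff u h x + secondDiff (ψ t) h x))| :=
        intervalIntegral.abs_integral_le_integral_abs hAR
    _ ≤ ∫ x in A..R, M * (2 * |secondDiff u h x| + |secondDiff (ψ t) h x|) := by
        refine intervalIntegral.integral_mono_on hAR
          (Continuous.intervalIntegrable (by fun_prop) _ _)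
          (Continuous.intervalIntegrable (by fun_prop) _ _) fun x _ => ?_
        rw [← mul_assoc, abs_mul, abs_mul, abs_of_pos (inv_pos.2 ht)]
        have h3 : t⁻¹ * |ψ t x| ≤ M := by
          rw [inv_mul_le_iff₀ ht, mul_comm]
          exact hψM x
        gcongr
        refine (abs_add_le _ _).trans ?_
        rw [abs_mul, abs_two]
    _ = M * (2 * (∫ x in A..R, |secondDiff u h x|) + ∫ x in A..R, |secondDiff (ψ t) h x|) := by
        rw [intervalIntegral.integral_const_mul, intervalIntegral.integral_add
          (Continuous.intervalIntegrable (by fun_prop) _ _)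
          (Continuous.intervalIntegrable (by fun_prop) _ _), intervalIntegral.integral_const_mul]
    _ ≤ _ := by gcongr

lemma measurable_integral_secondDiff_mul {w g : ℝ → ℝ} (hw : Continuous w) (hg : Continuous g)
    (hu : Continuous u) (a c : ℝ) : Measurable fun h =>
      ∫ x in a..c, g x * (2 * secondDiff u h x + secondDiff w h x) := by
  refine Continuous.measurable
    (intervalIntegral.continuous_parametric_intervalIntegral_of_continuous' (μ := volume) ?_ _ _)
  simp only [Function.uncurry_def]
  have h1 := continuous_secondDiff hw
  have h2 := continuous_secondDiff hu
  fun_prop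

lemma tendsto_integral_fracKernel_mul (hs : 0 < s) (hs1 : s < 1) {R C : ℝ}
    (hu : Continuous u) (hB : ∀ x, |u x| ≤ B) (hM : 0 ≤ M)
    (hAb : A < b) (hbR : b < R) (hRE : R ≤ E) (hτ : 0 < τ)
    (hψ : ∀ t ∈ Ioo 0 τ, Continuous (ψ t))
    (hψM : ∀ t ∈ Ioo 0 τ, ∀ x, |ψ t x| ≤ M * t)
    (hψ1 : ∀ t ∈ Ioo 0 τ, ∀ x ∈ Icc (A + t) b, ψ t x = M * t)
    (hψ0 : ∀ t ∈ Ioo 0 τ, ∀ x ∈ Icc (b + t) E, ψ t x = 0)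
    (hCu : ∀ h, ∫ x in A..R, |secondDiff u h x| ≤ C * min (h ^ 2) 1)
    (hCψ : ∀ t ∈ Ioo 0 τ, ∀ h, ∫ x in A..R, |secondDiff (ψ t) h x| ≤ C * min (h ^ 2) 1) :
    Tendsto (fun t => ∫ h, fracKernel s h *
        ∫ x in A..E, t⁻¹ * (ψ t x * (2 * secondDiff u h x + secondDiff (ψ t) h x)))
      (𝓝[>] 0) (𝓝 (∫ h, fracKernel s h * ∫ x in A..b, 2 * M * secondDiff u h x)) := by
  have hτ' : ∀ᶠ t in 𝓝[>] (0 : ℝ), t ∈ Ioo 0 τ := Ioo_mem_nhdsGT hτ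
  refine tendsto_integral_filter_of_dominated_convergence
    (fun h => M * (3 * C) * (min (h ^ 2) 1 * fracKernel s h)) ?_ ?_
    ((integrable_min_sq_mul_fracKernel hs hs1).const_mul _) ?_
  · filter_upwards [hτ'] with t ht
    have h1 := measurable_fracKernel s
    have h2 := measurable_integral_secondDiff_mul (hψ t ht) ((hψ t ht).const_smul t⁻¹) hu A E
    simp only [Pi.smul_apply, smul_eq_mul, mul_assoc] at h2
    exact (h1.mul h2).aestronglyMeasurable
  · filter_upwards [hτ', Ioo_mem_nhdsGT (sub_pos.2 hbR)] with t ht htR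
    refine Eventually.of_forall fun h => ?_
    have hk := fracKernel_nonneg s h
    have := abs_integral_mul_secondDiff_le (A := A) (E := E) (h := h) hu hM (by linarith) hRE
      ht.1 (hψ t ht) (hψM t ht)
      (fun x hx => hψ0 t ht x ⟨by linarith [htR.2, hx.1], hx.2⟩) (hCu h) (hCψ t ht h)
    rw [Real.norm_eq_abs, abs_mul, abs_of_nonneg hk]
    calc _ ≤ fracKernel s h * (M * (2 * (C * min (h ^ 2) 1) + C * min (h ^ 2) 1)) := by gcongr
      _ = _ := by ring
  · refine Eventually.of_forall fun h => Tendsto.const_mul _ ?_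
    exact tendsto_integral_mul_secondDiff hu hB hM hAb (hbR.trans_le hRE) hτ hψ hψM hψ1 hψ0 h

lemma integral_integral_secondDiff_mul_fracKernel (hs : 0 < s) (hs1 : s < 1) {C : ℝ}
    (hu : Continuous u) (hAb : A ≤ b)
    (hCu : ∀ h, ∫ x in A..b, |secondDiff u h x| ≤ C * min (h ^ 2) 1) :
    ∫ h, fracKernel s h * ∫ x in A..b, secondDiff u h x =
      ∫ x in Ioo A b, ∫ h, secondDiff u h x * fracKernel s h := by
  have hc := continuous_secondDiff hu
  have hmk := measurable_fracKernel s
  have cu : ∀ h, Continuous (secondDiff u h) := fun h => by unfold secondDiff; fun_prop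
  have hI : Integrable (Function.uncurry fun x h => secondDiff u h x * fracKernel s h)
      ((volume.restrict (Ioo A b)).prod volume) := by
    rw [integrable_prod_iff']
    · refine ⟨Eventually.of_forall fun h => ?_, ?_⟩
      · simp only [Function.uncurry_apply_pair]
        exact (((cu h).integrableOn_Icc.mono_set Ioo_subset_Icc_self)).mul_const _
      · have e : ∀ h, ∫ x in Ioo A b, ‖secondDiff u h x * fracKernel s h‖ =
            (∫ x in A..b, |secondDiff u h x|) * fracKernel s h := fun h => by
          simp only [Real.norm_eq_abs, abs_mul, abs_of_nonneg (fracKernel_nonneg s h)]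
          rw [integral_mul_const, intervalIntegral.integral_of_le hAb, integral_Ioc_eq_integral_Ioo]
        simp only [Function.uncurry_apply_pair, e]
        refine ((integrable_min_sq_mul_fracKernel hs hs1).const_mul C).mono' ?_
          (Eventually.of_forall fun h => ?_)
        · refine Measurable.aestronglyMeasurable (Measurable.mul (Continuous.measurable
            (intervalIntegral.continuous_parametric_intervalIntegral_of_continuous'
              (μ := volume) ?_ _ _)) hmk)
          exact hc.abs
        · have h0 : 0 ≤ ∫ x in A..b, |secondDiff u h x| :=
            intervalIntegral.integral_nonneg hAb fun x _ => abs_nonneg _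
          have hk := fracKernel_nonneg s h
          rw [Real.norm_eq_abs, abs_of_nonneg (mul_nonneg h0 hk), ← mul_assoc]
          gcongr
          exact hCu h
    · refine Measurable.aestronglyMeasurable ?_
      simp only [Function.uncurry_def]
      exact ((hc.comp continuous_swap).measurable).mul (hmk.comp measurable_snd)
  rw [integral_integral_swap hI]
  congr 1
  ext h
  rw [integral_mul_const, intervalIntegral.integral_of_le hAb, integral_Ioc_eq_integral_Ioo,
    mul_comm]

end limit

lemma integral_abs_secondDiff_le_min {ι : Type*} [Fintype ι] {w : ℝ → ℝ} (hw : Continuous w)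
    {α β lo hi a b r B : ℝ} (hB : ∀ x, |w x| ≤ B) (κ p : ι → ℝ)
    (hform : ∀ y ∈ Ioo lo hi, w y = β + α * y + ∑ i, κ i * ramp (p i) y)
    (hab : a ≤ b) (hr : 0 < r) (hr1 : r ≤ 1) (hlo : lo ≤ a - r) (hhi : b + r ≤ hi) (h : ℝ) :
    ∫ x in a..b, |secondDiff w h x| ≤
      ((∑ i, |κ i|) * 2 + 4 * B * (b - a) / r ^ 2) * min (h ^ 2) 1 := by
  have hB0 : 0 ≤ B := (abs_nonneg _).trans (hB 0)
  have hba := sub_nonneg.2 hab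
  refine le_mul_min_sq (f := fun h => ∫ x in a..b, |secondDiff w h x|) (by positivity)
    (by positivity) hr hr1 (fun h hh => ?_) (fun h => ?_) h
  · rw [mul_assoc]
    exact integral_abs_secondDiff_le hw κ p hform hab (by linarith) (by linarith)
  · have := intervalIntegral.norm_integral_le_of_norm_le_const (a := a) (b := b)
      (f := fun x => |secondDiff w h x|) (C := 4 * B)
      fun x _ => by simpa using abs_secondDiff_le hB h x
    rw [abs_of_nonneg hba] at this
    exact (le_abs_self _).trans this

lemma trapezoid_eq_sum (M a b t y : ℝ) : trapezoid M a b t y = 0 + 0 * y +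
    ∑ i : Fin 4, ![M, -M, -M, M] i * ramp (![a, a + t, b, b + t] i) y := by
  simp [Fin.sum_univ_four, trapezoid]
  ring

lemma eq_sum_ramp {u : ℝ → ℝ} {A b ε l m n : ℝ} (hAb : A ≤ b)
    (h1 : ∀ y ∈ Ioc (A - ε) A, u y = u A + m * (y - A))
    (h2 : ∀ y ∈ Icc A b, u y = u b + l * (y - b))
    (h3 : ∀ y ∈ Ico b (b + ε), u y = u b + n * (y - b)) :
    ∀ y ∈ Ioo (A - ε) (b + ε), u y = (u A - m * A) + m * y +
      ∑ i : Fin 2, ![l - m, n - l] i * ramp (![A, b] i) y := by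
  intro y hy
  have hA := h2 A ⟨le_rfl, hAb⟩
  simp only [Fin.sum_univ_two, Matrix.cons_val_zero, Matrix.cons_val_one, ramp]
  rcases le_total y A with h | h
  · rw [h1 y ⟨hy.1, h⟩, max_eq_right (by linarith), max_eq_right (by linarith)]
    ring
  rcases le_total y b with h' | h'
  · rw [h2 y ⟨h, h'⟩, max_eq_left (by linarith), max_eq_right (by linarith), hA]
    ring
  · rw [h3 y ⟨h', hy.2⟩, max_eq_left (by linarith), max_eq_left (by linarith), hA]
    ring

lemma integral_fracLap_eq {s : ℝ} (hs : 0 < s) (hs1 : s < 1) {u : ℝ → ℝ} (hu : Continuous u)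
    {A b B C l c : ℝ} (hB : ∀ x, |u x| ≤ B) (hAb : A ≤ b) (haff : ∀ y ∈ Icc A b, u y = c + l * y)
    (hCu : ∀ h, ∫ x in A..b, |secondDiff u h x| ≤ C * min (h ^ 2) 1) :
    ∫ x in Ioo A b, fracLap s u x = ∫ h, fracKernel s h * ∫ x in A..b, secondDiff u h x := by
  rw [integral_integral_secondDiff_mul_fracKernel hs hs1 hu hAb hCu]
  refine setIntegral_congr_fun measurableSet_Ioo fun x hx => ?_
  refine fracLap_eq_integral_secondDiff hs hs1 hu hB
    (lt_min (sub_pos.2 hx.1) (sub_pos.2 hx.2)) fun h hh => ?_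
  obtain ⟨h1, h2⟩ := lt_min_iff.1 hh
  obtain ⟨h3, h4⟩ := abs_lt.1 h1
  obtain ⟨h5, h6⟩ := abs_lt.1 h2
  rw [secondDiff, haff x ⟨hx.1.le, hx.2.le⟩, haff (x + h) ⟨by linarith, by linarith⟩,
    haff (x - h) ⟨by linarith, by linarith⟩]
  ring

lemma integral_fracKernel_mul_nonneg_of_minimizer {s Λ δ T ε C : ℝ} (hs : 0 < s) (hs1 : s < 1)
    (hΛ : 0 < Λ) (hδ : 0 < δ) {u : ℝ → ℝ} (hu : Admissible T Λ δ u)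
    (hmin : ∀ v : ℝ → ℝ, Admissible T Λ δ v → Fs s T u ≤ Fs s T v)
    {x₀ : ℝ} (hx₀ : ∀ x : ℝ, u x₀ ≤ u x)
    (hab : ∀ y ∈ Ioo (x₀ - δ) x₀, HasDerivAt u (-Λ) y)
    (hb : ∀ y ∈ Ioo x₀ (x₀ + ε), HasKinkAt u 1 1 y)
    (hε : 0 < ε) (hε1 : ε ≤ 1) (hεδ : ε ≤ δ) (hεT : ε ≤ T - δ)
    (hCu : ∀ h, ∫ x in (x₀ - δ)..(x₀ + ε / 2), |secondDiff u h x| ≤ C * min (h ^ 2) 1) :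
    0 ≤ ∫ h, fracKernel s h * ∫ x in (x₀ - δ)..x₀, 2 * (1 + Λ) * secondDiff u h x := by
  have hT : 0 < T := by linarith
  have hM : 0 ≤ 1 + Λ := by linarith
  have huk := hu.hasAdmissibleKinks
  obtain ⟨B, -, hB⟩ := exists_bound_of_continuous_periodic hT hu.cont hu.per
  set ψ : ℝ → ℝ → ℝ := bump hT (1 + Λ) (x₀ - δ) x₀ with hψdef
  have hadm : ∀ t ∈ Ioo 0 (ε / 2), Admissible T Λ δ (u + ψ t) := fun t ht =>
    admissible_add_bump hT hΛ hδ hu hx₀ hab hb ht.1 (by linarith [ht.2]) (by linarith [ht.2])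
      (by linarith [ht.2])
  have hψ : ∀ t ∈ Ioo 0 (ε / 2), Continuous (ψ t) := fun t ht => by
    simpa using (hadm t ht).cont.sub hu.cont
  have hψp : ∀ t, Function.Periodic (ψ t) T := fun t => bump_periodic hT _ _ _ _
  have hψM : ∀ t ∈ Ioo 0 (ε / 2), ∀ x, |ψ t x| ≤ (1 + Λ) * t := fun t ht x =>
    abs_bump_le hT hM ht.1.le x
  have hψe : ∀ t ∈ Ioo 0 (ε / 2), ∀ x ∈ Ioo (x₀ + t - T) (x₀ - δ + T),
      ψ t x = trapezoid (1 + Λ) (x₀ - δ) x₀ t x := fun t ht x hx =>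
    bump_eq_trapezoid hT _ (by linarith) ht.1.le hx
  have hlim := tendsto_integral_fracKernel_mul (E := x₀ - δ + T)
    (C := max C ((∑ i, |![1 + Λ, -(1 + Λ), -(1 + Λ), 1 + Λ] i|) * 2 +
      4 * ((1 + Λ) * (ε / 2)) * (x₀ + ε / 2 - (x₀ - δ)) / (ε / 2) ^ 2)) hs hs1 hu.cont hB hM
    (by linarith : x₀ - δ < x₀) (by linarith : x₀ < x₀ + ε / 2) (by linarith)
    (by linarith : 0 < ε / 2) hψ hψM
    (fun t ht x hx => by
      rw [hψe t ht x ⟨by linarith [hx.1, ht.2], by linarith [hx.2]⟩,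
        trapezoid_eq_of_mem hx.1 ht.1.le hx.2])
    (fun t ht x hx => by
      rcases hx.2.eq_or_lt with rfl | h
      · rw [hψp t, hψe t ht _ ⟨by linarith [ht.2], by linarith⟩,
          trapezoid_eq_zero_of_le (by linarith) ht.1.le le_rfl]
      · rw [hψe t ht x ⟨by linarith [hx.1, ht.2], h⟩,
          trapezoid_eq_zero_of_ge (by linarith) ht.1.le hx.1])
    (fun h => (hCu h).trans (by gcongr; exact le_max_left _ _))
    (fun t ht h => by
      refine (integral_abs_secondDiff_le_min (hψ t ht)
        (fun x => (hψM t ht x).trans (by gcongr; exact ht.2.le : _ ≤ (1 + Λ) * (ε / 2)))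
        _ _ (fun y hy => (hψe t ht y hy).trans (trapezoid_eq_sum _ _ _ _ _)) (by linarith)
        (by linarith : 0 < ε / 2) (by linarith) (by linarith [ht.2]) (by linarith) h).trans ?_
      gcongr
      exact le_max_right _ _)
  refine ge_of_tendsto hlim ?_
  filter_upwards [Ioo_mem_nhdsGT (by linarith : 0 < ε / 2)] with t ht
  have ht0 : 0 < t := ht.1
  have h1 := sub_nonneg.2 (hmin _ (hadm t ht))
  rw [Fs_add_sub hs hs1 hT hu.cont (hψ t ht) hu.per (hψp t) (huk.abs_sub_le hΛ)
    ((hadm t ht).hasAdmissibleKinks.abs_sub_le hΛ) (x₀ - δ)] at h1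
  have h2 := nonneg_of_mul_nonneg_right h1 (by positivity)
  simp only [intervalIntegral.integral_const_mul, mul_left_comm _ t⁻¹]
  rw [integral_const_mul]
  positivity

/-- at a global minimum point `x₀` of a minimizer `u`, the slope is `-Λ` on
`(x₀ - δ, x₀)` and the fractional Laplacian has nonnegative average there. -/
theorem statement13 (s Λ δ T : ℝ) (L : ℕ)
    (hs : 0 < s) (hs1 : s < 1) (hΛ : 0 < Λ) (hδ : 0 < δ) (hL : 0 < L)
    (hT : T = (L : ℝ) * ((Λ + 1) * δ))
    (u : ℝ → ℝ) (hu : Admissible T Λ δ u)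
    (hmin : ∀ v : ℝ → ℝ, Admissible T Λ δ v → Fs s T u ≤ Fs s T v)
    (x₀ : ℝ) (hx₀ : ∀ x : ℝ, u x₀ ≤ u x) :
    (∀ x ∈ Set.Ioo (x₀ - δ) x₀, HasDerivAt u (-Λ) x) ∧
    0 ≤ ∫ x in Set.Ioo (x₀ - δ) x₀, fracLap s u x := by
  have hT' : δ + Λ * δ ≤ T := by
    have : (1 : ℝ) ≤ L := by exact_mod_cast hL
    have h0 : 0 < (Λ + 1) * δ := by positivity
    nlinarith
  have hΛδ : 0 < Λ * δ := by positivity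
  have hT0 : 0 < T := by linarith
  have huk := hu.hasAdmissibleKinks
  have hk := huk.hasKinkAt_of_min hΛ hx₀
  have hab : ∀ x ∈ Ioo (x₀ - δ) x₀, HasDerivAt u (-Λ) x := by
    obtain ⟨a, ha1, ha2, ha3⟩ := hu.negRegion
    simp only [subsingleton_Icc_inter_Icc_iff hδ] at ha3
    obtain ⟨k, hk⟩ := exists_interval_of_min hΛ hδ huk ha1 ha2 ha3 hx₀
    intro x hx
    exact ha1 k ⟨by linarith [hx.1], by linarith [hx.2]⟩
  refine ⟨hab, ?_⟩
  obtain ⟨B, -, hB⟩ := exists_bound_of_continuous_periodic hT0 hu.cont hu.per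
  obtain ⟨m, n, -, -, hA⟩ := huk (x₀ - δ)
  obtain ⟨ε₁, hε₁, h1, -⟩ := hA.exists_pos
  obtain ⟨ε₂, hε₂, -, h3⟩ := hk.exists_pos
  have h2 := eq_affine_of_hasDerivAt hu.cont (by linarith) hab
  obtain ⟨ε, hε, hle⟩ : ∃ ε > 0, ε ≤ ε₁ ∧ ε ≤ ε₂ ∧ ε ≤ 1 ∧ ε ≤ δ ∧ ε ≤ T - δ :=
    ⟨min ε₁ (min ε₂ (min 1 (min δ (T - δ)))),
      lt_min hε₁ (lt_min hε₂ (lt_min one_pos (lt_min hδ (by linarith)))), by simp⟩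
  obtain ⟨l1, l2, l3, l4, l5⟩ := hle
  have hform := eq_sum_ramp (by linarith) (fun y hy => h1 y ⟨by linarith [hy.1], hy.2⟩) h2
    (fun y hy => h3 y ⟨hy.1, by linarith [hy.2]⟩) (ε := ε)
  have hb : ∀ y ∈ Ioo x₀ (x₀ + ε), HasKinkAt u 1 1 y := fun y hy =>
    .of_mem_Ioo (c := u x₀ - x₀)
      (fun z hz => by rw [h3 z ⟨hz.1.le, by linarith [hz.2]⟩]; ring) hy
  have hCu := fun {b} (h0 : x₀ - δ ≤ b) (hb : b ≤ x₀ + ε / 2) =>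
    integral_abs_secondDiff_le_min hu.cont hB _ _ hform h0 (half_pos hε) (by linarith)
      (by linarith) (by linarith)
  have hpos := integral_fracKernel_mul_nonneg_of_minimizer hs hs1 hΛ hδ hu hmin hx₀ hab hb hε
    l3 l4 l5 (hCu (by linarith) le_rfl)
  rw [integral_fracLap_eq hs hs1 hu.cont hB (by linarith)
    (fun y hy => (h2 y hy).trans (by ring : _ = (u x₀ + Λ * x₀) + (-Λ) * y))
    (hCu (by linarith) (by linarith))]
  simp only [intervalIntegral.integral_const_mul, mul_left_comm _ (2 * (1 + Λ))] at hpos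
  rw [integral_const_mul] at hpos
  exact nonneg_of_mul_nonneg_right hpos (by positivity)
end
end

section
/- Let 1/2 < s < 1, let δ_n be a positive sequence with δ_n → 0, set Λ_n = 1/δ_n, and let ū_n be the (1+δ_n)-periodic function with ū_n(x) = −Λ_n x on (−δ_n, 0) and ū_n(x) = x on [0, 1]. Then lim_{n→∞} δ_n^{2s−1} · (1/2) ∫_0^1 ∫_{1+δ_n}^{2+δ_n} |ū_n(x)−ū_n(y)|²/|x−y|^{1+2s} dy dx = 1/(4s(2s−1)). -/
open MeasureTheory Filter Set Topology

noncomputable section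

theorem ubar_of_mem_Ioo {d x : ℝ} (hd : 0 < d) (hx : x ∈ Ioo (0 : ℝ) 1) :
    ubar (1 / d) d x = x := by
  have hT : (1 / d + 1) * d = 1 + d := by field_simp
  have hfr : Int.fract ((x + d) / (1 + d)) = (x + d) / (1 + d) := by
    rw [Int.fract_eq_self]
    exact ⟨by have := hx.1; positivity, by rw [div_lt_one (by positivity)]; linarith [hx.2]⟩
  have hy : (1 + d) * ((x + d) / (1 + d)) - d = x := by field_simp; ring
  simp only [ubar, hT, hfr, hy, if_neg hx.1.not_gt]

theorem ubar_add_period {d : ℝ} (hd : 0 < d) (x : ℝ) :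
    ubar (1 / d) d (x + (1 + d)) = ubar (1 / d) d x := by
  have hT : (1 / d + 1) * d = 1 + d := by field_simp
  have hfr : Int.fract ((x + (1 + d) + d) / (1 + d)) = Int.fract ((x + d) / (1 + d)) := by
    rw [show (x + (1 + d) + d) / (1 + d) = (x + d) / (1 + d) + 1 by field_simp; ring,
      Int.fract_add_one]
  simp only [ubar, hT, hfr]

theorem ubar_of_mem_Ioo_add_period {d y : ℝ} (hd : 0 < d) (hy : y ∈ Ioo (1 + d) (2 + d)) :
    ubar (1 / d) d y = y - (1 + d) := by
  rw [← ubar_of_mem_Ioo hd (x := y - (1 + d)) ⟨by linarith [hy.1], by linarith [hy.2]⟩,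
    ← ubar_add_period hd (y - (1 + d)), sub_add_cancel]

theorem intervalIntegrable_sub_rpow {a b x : ℝ} (hab : a ≤ b) (hx : x < a) (p : ℝ) :
    IntervalIntegrable (fun y => (y - x) ^ p) volume a b := by
  refine ContinuousOn.intervalIntegrable fun y hy => ?_
  rw [uIcc_of_le hab] at hy
  exact ((continuousAt_id.sub continuousAt_const).rpow_const
    (Or.inl (sub_pos.2 (hx.trans_le hy.1)).ne')).continuousWithinAt

theorem integral_sub_rpow {a b x p : ℝ} (hab : a ≤ b) (hx : x < a) (hp : p ≠ -1) :
    ∫ y in a..b, (y - x) ^ p = ((b - x) ^ (p + 1) - (a - x) ^ (p + 1)) / (p + 1) := by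
  rw [intervalIntegral.integral_comp_sub_right (fun u => u ^ p), integral_rpow]
  refine Or.inr ⟨hp, ?_⟩
  rw [uIcc_of_le (by linarith)]
  exact fun h => by linarith [h.1]

theorem intervalIntegrable_const_sub_rpow {a : ℝ} (ha : 1 < a) (p : ℝ) :
    IntervalIntegrable (fun x => (a - x) ^ p) volume 0 1 := by
  refine ContinuousOn.intervalIntegrable fun x hx => ?_
  rw [uIcc_of_le zero_le_one] at hx
  exact ((continuousAt_const.sub continuousAt_id).rpow_const
    (Or.inl (sub_pos.2 (hx.2.trans_lt ha)).ne')).continuousWithinAt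

theorem integral_const_sub_rpow {a p : ℝ} (ha : 1 < a) (hp : p ≠ -1) :
    ∫ x in (0 : ℝ)..1, (a - x) ^ p = (a ^ (p + 1) - (a - 1) ^ (p + 1)) / (p + 1) := by
  rw [intervalIntegral.integral_comp_sub_left (fun u => u ^ p), integral_rpow, sub_zero]
  refine Or.inr ⟨hp, ?_⟩
  rw [uIcc_of_le (by linarith)]
  exact fun h => by linarith [h.1]

/-- The integral of `(y - x) ^ p` over `y ∈ (1 + d, 2 + d)`. -/
def innerPow (d p x : ℝ) : ℝ :=
  ((2 + d - x) ^ (p + 1) - (1 + d - x) ^ (p + 1)) / (p + 1)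

/-- The integral of `(y - x) ^ p` over `x ∈ (0, 1)`, `y ∈ (1 + d, 2 + d)`. -/
def doublePow (d p : ℝ) : ℝ :=
  ((2 + d) ^ (p + 2) - 2 * (1 + d) ^ (p + 2) + d ^ (p + 2)) / ((p + 1) * (p + 2))

theorem intervalIntegrable_innerPow {d : ℝ} (hd : 0 < d) (p : ℝ) :
    IntervalIntegrable (innerPow d p) volume 0 1 :=
  ((intervalIntegrable_const_sub_rpow (by linarith) _).sub
    (intervalIntegrable_const_sub_rpow (by linarith) _)).div_const _

theorem integral_innerPow {d p : ℝ} (hd : 0 < d) (hp1 : p ≠ -1) (hp2 : p ≠ -2) :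
    ∫ x in (0 : ℝ)..1, innerPow d p x = doublePow d p := by
  have h1 : p + 1 ≠ 0 := fun h => hp1 (by linarith)
  have h2 : p + 2 ≠ 0 := fun h => hp2 (by linarith)
  have h3 : p + 1 ≠ -1 := fun h => hp2 (by linarith)
  unfold innerPow doublePow
  rw [intervalIntegral.integral_div, intervalIntegral.integral_sub
    (intervalIntegrable_const_sub_rpow (by linarith) _)
    (intervalIntegrable_const_sub_rpow (by linarith) _),
    integral_const_sub_rpow (by linarith) h3, integral_const_sub_rpow (by linarith) h3,
    show p + 1 + 1 = p + 2 by ring, show 2 + d - 1 = 1 + d by ring, add_sub_cancel_left]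
  field_simp
  ring

theorem integral_ubar_inner {d s x : ℝ} (hd : 0 < d) (hs : 1 / 2 < s) (hs1 : s < 1)
    (hx : x ∈ Ioo (0 : ℝ) 1) :
    ∫ y in Ioo (1 + d) (2 + d),
        (ubar (1 / d) d x - ubar (1 / d) d y) ^ 2 / |x - y| ^ (1 + 2 * s) =
      (1 + d) ^ 2 * innerPow d (-1 - 2 * s) x - 2 * (1 + d) * innerPow d (-2 * s) x +
        innerPow d (1 - 2 * s) x := by
  have hab : 1 + d ≤ 2 + d := by linarith
  have hxa : x < 1 + d := by linarith [hx.2]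
  have hint := intervalIntegrable_sub_rpow hab hxa
  have hcongr : ∫ y in Ioo (1 + d) (2 + d),
        (ubar (1 / d) d x - ubar (1 / d) d y) ^ 2 / |x - y| ^ (1 + 2 * s) =
      ∫ y in Ioo (1 + d) (2 + d), ((1 + d) ^ 2 * (y - x) ^ (-1 - 2 * s) -
        2 * (1 + d) * (y - x) ^ (-2 * s) + (y - x) ^ (1 - 2 * s)) := by
    refine setIntegral_congr_fun measurableSet_Ioo fun y hy => ?_
    have hr : 0 < y - x := by linarith [hy.1]
    have e1 : (y - x) ^ (-2 * s) = (y - x) * (y - x) ^ (-1 - 2 * s) := by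
      rw [← Real.rpow_one_add' hr.le (by linarith)]; ring_nf
    have e2 : (y - x) ^ (1 - 2 * s) = (y - x) * (y - x) ^ (-2 * s) := by
      rw [← Real.rpow_one_add' hr.le (by linarith)]; ring_nf
    have e3 : (y - x) ^ (-1 - 2 * s) = ((y - x) ^ (1 + 2 * s))⁻¹ := by
      rw [← Real.rpow_neg hr.le]; ring_nf
    rw [ubar_of_mem_Ioo hd hx, ubar_of_mem_Ioo_add_period hd hy, abs_sub_comm, abs_of_pos hr,
      e2, e1, e3]
    ring
  rw [hcongr, ← integral_Ioc_eq_integral_Ioo, ← intervalIntegral.integral_of_le hab,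
    intervalIntegral.integral_add (((hint _).const_mul _).sub ((hint _).const_mul _)) (hint _),
    intervalIntegral.integral_sub ((hint _).const_mul _) ((hint _).const_mul _),
    intervalIntegral.integral_const_mul, intervalIntegral.integral_const_mul,
    integral_sub_rpow hab hxa (by linarith), integral_sub_rpow hab hxa (by linarith),
    integral_sub_rpow hab hxa (by linarith)]
  rfl

theorem integral_ubar {d s : ℝ} (hd : 0 < d) (hs : 1 / 2 < s) (hs1 : s < 1) :
    ∫ x in Ioo (0 : ℝ) 1, ∫ y in Ioo (1 + d) (2 + d),
        (ubar (1 / d) d x - ubar (1 / d) d y) ^ 2 / |x - y| ^ (1 + 2 * s) =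
      (1 + d) ^ 2 * doublePow d (-1 - 2 * s) - 2 * (1 + d) * doublePow d (-2 * s) +
        doublePow d (1 - 2 * s) := by
  have hint := intervalIntegrable_innerPow hd
  rw [setIntegral_congr_fun measurableSet_Ioo fun x hx => integral_ubar_inner hd hs hs1 hx,
    ← integral_Ioc_eq_integral_Ioo, ← intervalIntegral.integral_of_le zero_le_one,
    intervalIntegral.integral_add (((hint _).const_mul _).sub ((hint _).const_mul _)) (hint _),
    intervalIntegral.integral_sub ((hint _).const_mul _) ((hint _).const_mul _),
    intervalIntegral.integral_const_mul, intervalIntegral.integral_const_mul,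
    integral_innerPow hd (by linarith) (by linarith),
    integral_innerPow hd (by linarith) (by linarith),
    integral_innerPow hd (by linarith) (by linarith)]

theorem tendsto_rpow_mul_doublePow {q p L : ℝ} (hq : 0 < q) {δ : ℕ → ℝ}
    (hδ0 : Tendsto δ atTop (𝓝 0))
    (hL : Tendsto (fun n => δ n ^ q * δ n ^ (p + 2)) atTop (𝓝 L)) :
    Tendsto (fun n => δ n ^ q * doublePow (δ n) p) atTop (𝓝 (L / ((p + 1) * (p + 2)))) := by
  have h0 : Tendsto (fun n => δ n ^ q) atTop (𝓝 0) := by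
    simpa [Real.zero_rpow hq.ne'] using hδ0.rpow_const (p := q) (Or.inr hq.le)
  have h1 : Tendsto (fun n => (1 + δ n) ^ (p + 2)) atTop (𝓝 ((1 + 0) ^ (p + 2))) :=
    (hδ0.const_add 1).rpow_const (Or.inl (by norm_num))
  have h2 : Tendsto (fun n => (2 + δ n) ^ (p + 2)) atTop (𝓝 ((2 + 0) ^ (p + 2))) :=
    (hδ0.const_add 2).rpow_const (Or.inl (by norm_num))
  convert ((h0.mul (h2.sub (h1.const_mul 2))).add hL).div_const ((p + 1) * (p + 2)) using 2
  · unfold doublePow; ring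
  · ring

theorem tendsto_rpow_mul_rpow_zero {q r : ℝ} (hqr : 0 < q + r) {δ : ℕ → ℝ}
    (hδpos : ∀ n, 0 < δ n) (hδ0 : Tendsto δ atTop (𝓝 0)) :
    Tendsto (fun n => δ n ^ q * δ n ^ r) atTop (𝓝 0) := by
  simpa [← Real.rpow_add (hδpos _), Real.zero_rpow hqr.ne'] using
    hδ0.rpow_const (p := q + r) (Or.inr hqr.le)

/-- asymptotics of the interaction `𝓘ⁿ₈` for `1/2 < s < 1`. -/
theorem statement14 (s : ℝ) (hs : 1 / 2 < s) (hs1 : s < 1)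
    (δ : ℕ → ℝ) (hδpos : ∀ n, 0 < δ n) (hδ0 : Tendsto δ atTop (𝓝 0)) :
    Tendsto (fun n => (δ n) ^ (2 * s - 1) *
        ((1 / 2) * ∫ x in Set.Ioo (0 : ℝ) 1, ∫ y in Set.Ioo (1 + δ n) (2 + δ n),
          (ubar (1 / δ n) (δ n) x - ubar (1 / δ n) (δ n) y) ^ 2 / |x - y| ^ (1 + 2 * s)))
      atTop (𝓝 (1 / (4 * s * (2 * s - 1)))) := by
  have hq : 0 < 2 * s - 1 := by linarith
  have hA := tendsto_rpow_mul_doublePow (p := -1 - 2 * s) (L := 1) hq hδ0 <| by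
    refine tendsto_const_nhds.congr fun n => ?_
    rw [← Real.rpow_add (hδpos n), show 2 * s - 1 + (-1 - 2 * s + 2) = 0 by ring,
      Real.rpow_zero]
  have hB := tendsto_rpow_mul_doublePow (p := -2 * s) hq hδ0
    (tendsto_rpow_mul_rpow_zero (by linarith) hδpos hδ0)
  have hC := tendsto_rpow_mul_doublePow (p := 1 - 2 * s) hq hδ0
    (tendsto_rpow_mul_rpow_zero (by linarith) hδpos hδ0)
  have hc := hδ0.const_add 1
  convert ((((hc.pow 2).mul hA).sub ((hc.const_mul 2).mul hB)).add hC).const_mul (1 / 2) using 2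
  · rw [integral_ubar (hδpos _) hs hs1]
    ring
  · have h1 : s ≠ 0 := by linarith
    have h2 : 2 * s - 1 ≠ 0 := hq.ne'
    rw [show (-1 - 2 * s + 1) * (-1 - 2 * s + 2) = 2 * s * (2 * s - 1) by ring]
    simp only [zero_div, mul_zero, sub_zero, add_zero]
    field_simp
    norm_num
end
end

section
/- Let s = 1/2, let δ_n be a positive sequence with δ_n → 0, set Λ_n = 1/δ_n, and let ū_n be the (1+δ_n)-periodic function with ū_n(x) = −Λ_n x on (−δ_n, 0) and ū_n(x) = x on [0, 1]. Then lim_{n→∞} (1/log(1/δ_n)) · (1/2) ∫_0^1 ∫_{1+δ_n}^{2+δ_n} |ū_n(x)−ū_n(y)|²/|x−y|² dy dx = 1/2. -/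
open MeasureTheory Filter Set Topology

noncomputable section

lemma ubar_inv_of_mem {δ x : ℝ} (hδ : 0 < δ) (hx : x ∈ Ioo (0 : ℝ) 1) :
    ubar (1 / δ) δ x = x := by
  have hT : (1 / δ + 1) * δ = 1 + δ := by field_simp
  have hfr : Int.fract ((x + δ) / (1 + δ)) = (x + δ) / (1 + δ) := by
    rw [Int.fract_eq_self]
    exact ⟨div_nonneg (by linarith [hx.1]) (by linarith),
      (div_lt_one (by linarith)).2 (by linarith [hx.2])⟩
  have hy : (1 + δ) * ((x + δ) / (1 + δ)) - δ = x := by field_simp; ring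
  simp only [ubar, hT, hfr, hy]
  exact if_neg hx.1.not_gt

lemma ubar_inv_add_period {δ : ℝ} (hδ : 0 < δ) (x : ℝ) :
    ubar (1 / δ) δ (x + (1 + δ)) = ubar (1 / δ) δ x := by
  have hT : (1 / δ + 1) * δ = 1 + δ := by field_simp
  have hq : (x + (1 + δ) + δ) / (1 + δ) = (x + δ) / (1 + δ) + 1 := by field_simp; ring
  simp only [ubar, hT, hq, Int.fract_add_one]

lemma integral_Ioo_sq_div_sq {T x : ℝ} (hx : x < T) :
    ∫ y in Ioo T (T + 1), (x - (y - T)) ^ 2 / |x - y| ^ 2 =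
      T ^ 2 / (T - x) - T ^ 2 / (T + 1 - x)
        - 2 * T * (Real.log (T + 1 - x) - Real.log (T - x)) + 1 := by
  rw [← integral_Ioc_eq_integral_Ioo, ← intervalIntegral.integral_of_le (by linarith)]
  have hpos : ∀ y ∈ uIcc T (T + 1), 0 < y - x := by
    intro y hy
    rw [uIcc_of_le (by linarith)] at hy
    linarith [hy.1]
  rw [intervalIntegral.integral_eq_sub_of_hasDerivAt
    (f := fun y => -(T ^ 2 / (y - x)) - 2 * T * Real.log (y - x) + y)]
  · ring
  · intro y hy
    have h0 := (hpos y hy).ne'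
    have hd : HasDerivAt (fun y => y - x) 1 y := (hasDerivAt_id y).sub_const x
    refine ((((((hasDerivAt_const y (T ^ 2)).div hd h0).neg).sub
      ((hd.log h0).const_mul (2 * T))).add (hasDerivAt_id y))).congr_deriv ?_
    rw [sq_abs, show (x - y) ^ 2 = (y - x) ^ 2 by ring]
    field_simp
    ring
  · refine ContinuousOn.intervalIntegrable (ContinuousOn.div (by fun_prop) (by fun_prop) ?_)
    intro y hy
    have h0 := hpos y hy
    rw [sq_abs]
    exact pow_ne_zero 2 (by linarith : x - y < 0).ne

lemma integral_Ioo_interaction {δ : ℝ} (hδ : 0 < δ) :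
    ∫ x in Ioo (0 : ℝ) 1, ((1 + δ) ^ 2 / (1 + δ - x) - (1 + δ) ^ 2 / (1 + δ + 1 - x)
        - 2 * (1 + δ) * (Real.log (1 + δ + 1 - x) - Real.log (1 + δ - x)) + 1) =
      (1 + δ) ^ 2 * (2 * Real.log (1 + δ) - Real.log (2 + δ) - Real.log δ)
        - 2 * (1 + δ) * ((2 + δ) * Real.log (2 + δ) - 2 * ((1 + δ) * Real.log (1 + δ))
          + δ * Real.log δ) + 1 := by
  rw [← integral_Ioc_eq_integral_Ioo, ← intervalIntegral.integral_of_le zero_le_one]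
  have hpos : ∀ x ∈ uIcc (0 : ℝ) 1, 0 < 1 + δ - x ∧ 0 < 1 + δ + 1 - x := by
    intro x hx
    rw [uIcc_of_le zero_le_one] at hx
    constructor <;> linarith [hx.2]
  rw [intervalIntegral.integral_eq_sub_of_hasDerivAt
    (f := fun x => (1 + δ) ^ 2 * (Real.log (1 + δ + 1 - x) - Real.log (1 + δ - x))
      + 2 * (1 + δ) * (((1 + δ + 1 - x) * Real.log (1 + δ + 1 - x) - (1 + δ + 1 - x))
        - ((1 + δ - x) * Real.log (1 + δ - x) - (1 + δ - x))) + x)]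
  · rw [show 1 + δ + 1 - 1 = 1 + δ by ring, show 1 + δ - 1 = δ by ring,
      show 1 + δ + 1 - 0 = 2 + δ by ring, sub_zero]
    ring
  · intro x hx
    obtain ⟨h1, h2⟩ := hpos x hx
    have hd (c : ℝ) : HasDerivAt (fun x => c - x) (-1) x := (hasDerivAt_id x).const_sub c
    have hl1 := (hd (1 + δ)).log h1.ne'
    have hl2 := (hd (1 + δ + 1)).log h2.ne'
    refine ((((hl2.sub hl1).const_mul ((1 + δ) ^ 2)).add
      (((((hd (1 + δ + 1)).mul hl2).sub (hd (1 + δ + 1))).sub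
        (((hd (1 + δ)).mul hl1).sub (hd (1 + δ)))).const_mul (2 * (1 + δ)))).add
      (hasDerivAt_id x)).congr_deriv ?_
    field_simp
    ring
  · refine ContinuousOn.intervalIntegrable ?_
    fun_prop (disch := intro x hx; first | exact (hpos x hx).1.ne' | exact (hpos x hx).2.ne')

/-- asymptotics of the interaction `𝓘ⁿ₈` for `s = 1/2`. -/
theorem statement15
    (δ : ℕ → ℝ) (hδpos : ∀ n, 0 < δ n) (hδ0 : Tendsto δ atTop (𝓝 0)) :
    Tendsto (fun n => (1 / Real.log (1 / δ n)) *
        ((1 / 2) * ∫ x in Set.Ioo (0 : ℝ) 1, ∫ y in Set.Ioo (1 + δ n) (2 + δ n),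
          (ubar (1 / δ n) (δ n) x - ubar (1 / δ n) (δ n) y) ^ 2 / |x - y| ^ 2))
      atTop (𝓝 (1 / 2)) := by
  have hI : ∀ n, ∫ x in Set.Ioo (0 : ℝ) 1, ∫ y in Set.Ioo (1 + δ n) (2 + δ n),
      (ubar (1 / δ n) (δ n) x - ubar (1 / δ n) (δ n) y) ^ 2 / |x - y| ^ 2 =
      (1 + δ n) ^ 2 * (2 * Real.log (1 + δ n) - Real.log (2 + δ n) - Real.log (δ n))
        - 2 * (1 + δ n) * ((2 + δ n) * Real.log (2 + δ n)
          - 2 * ((1 + δ n) * Real.log (1 + δ n)) + δ n * Real.log (δ n)) + 1 := by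
    intro n
    have hn := hδpos n
    rw [← integral_Ioo_interaction hn]
    refine setIntegral_congr_fun measurableSet_Ioo fun x hx => ?_
    rw [← integral_Ioo_sq_div_sq (by linarith [hx.2]), show 1 + δ n + 1 = 2 + δ n by ring]
    refine setIntegral_congr_fun measurableSet_Ioo fun y hy => ?_
    have hy' : y - (1 + δ n) ∈ Ioo (0 : ℝ) 1 := ⟨by linarith [hy.1], by linarith [hy.2]⟩
    have h := ubar_inv_add_period hn (y - (1 + δ n))
    rw [sub_add_cancel, ubar_inv_of_mem hn hy'] at h
    simp only [h, ubar_inv_of_mem hn hx]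
  let G : ℝ → ℝ := fun d => (1 + d) ^ 2 * (2 * Real.log (1 + d) - Real.log (2 + d))
    - 2 * (1 + d) * ((2 + d) * Real.log (2 + d) - 2 * ((1 + d) * Real.log (1 + d))
      + d * Real.log d) + 1
  have hG : ContinuousAt G 0 := by
    have hlog : ContinuousAt (fun d : ℝ => d * Real.log d) 0 :=
      Real.continuous_mul_log.continuousAt
    have h1 : ContinuousAt (fun d : ℝ => Real.log (1 + d)) 0 :=
      ContinuousAt.log (by fun_prop) (by norm_num)
    have h2 : ContinuousAt (fun d : ℝ => Real.log (2 + d)) 0 :=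
      ContinuousAt.log (by fun_prop) (by norm_num)
    fun_prop
  have hL : Tendsto (fun n => Real.log (1 / δ n)) atTop atTop := by
    refine Real.tendsto_log_atTop.comp ?_
    simp only [one_div]
    exact tendsto_inv_nhdsGT_zero.comp
      (tendsto_nhdsWithin_iff.2 ⟨hδ0, Eventually.of_forall hδpos⟩)
  have hlim : Tendsto (fun n => (1 / 2) * ((1 + δ n) ^ 2 + (Real.log (1 / δ n))⁻¹ * G (δ n)))
      atTop (𝓝 ((1 / 2) * ((1 + 0) ^ 2 + 0 * G 0))) :=
    (((hδ0.const_add 1).pow 2).add (hL.inv_tendsto_atTop.mul (hG.tendsto.comp hδ0))).const_mul _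
  rw [show (1 / 2 : ℝ) * ((1 + 0) ^ 2 + 0 * G 0) = 1 / 2 by ring] at hlim
  refine hlim.congr' ?_
  filter_upwards [hL.eventually_gt_atTop 0] with n hn
  have hlogδ : Real.log (δ n) = -Real.log (1 / δ n) := by rw [one_div, Real.log_inv, neg_neg]
  rw [hI n]
  simp only [G, hlogδ]
  field_simp
  ring
end
end

section
/- Let 1/2 < s < 1, let δ_n be a positive sequence with δ_n → 0, set Λ_n = 1/δ_n, and let ū_n be the (1+δ_n)-periodic function with ū_n(x) = −Λ_n x on (−δ_n, 0) and ū_n(x) = x on [0, 1]. Then lim_{n→∞} δ_n^{2s−1} · (1/2) ∫_{−δ_n}^0 ∫_0^1 |ū_n(x)−ū_n(y)|²/|x−y|^{1+2s} dy dx = 1/(4s(3−2s)). -/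
open MeasureTheory Filter Set Topology

noncomputable section

lemma ubar_one_div_of_neg {d x : ℝ} (hd : 0 < d) (hx : x ∈ Ioo (-d) 0) :
    ubar (1 / d) d x = x / (-d) := by
  have hT : (1 / d + 1) * d = 1 + d := by field_simp
  have hfract : Int.fract ((x + d) / (1 + d)) = (x + d) / (1 + d) := by
    rw [Int.fract_eq_self]
    refine ⟨div_nonneg (by linarith [hx.1]) (by linarith), ?_⟩
    rw [div_lt_one (by linarith)]
    linarith [hx.2]
  have hy : (1 + d) * ((x + d) / (1 + d)) - d = x := by field_simp; ring
  simp only [ubar, hT, hfract, hy, if_pos hx.2]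
  field_simp

lemma ubar_one_div_of_pos {d y : ℝ} (hd : 0 < d) (hy : y ∈ Ioo 0 1) :
    ubar (1 / d) d y = y := by
  have hT : (1 / d + 1) * d = 1 + d := by field_simp
  have hfract : Int.fract ((y + d) / (1 + d)) = (y + d) / (1 + d) := by
    rw [Int.fract_eq_self]
    refine ⟨div_nonneg (by linarith [hy.1]) (by linarith), ?_⟩
    rw [div_lt_one (by linarith)]
    linarith [hy.2]
  have hy' : (1 + d) * ((y + d) / (1 + d)) - d = y := by field_simp; ring
  simp only [ubar, hT, hfract, hy', if_neg (not_lt.2 hy.1.le)]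

/-- An antiderivative of `v ↦ (c - v) ^ 2 / v ^ (1 + 2 * s)` on the positive half-line. -/
def kernelPrimitive (s c v : ℝ) : ℝ :=
  c ^ 2 * (v ^ (-(2 * s)) / (-(2 * s))) - 2 * c * (v ^ (1 - 2 * s) / (1 - 2 * s))
    + v ^ (2 - 2 * s) / (2 - 2 * s)

lemma hasDerivAt_kernelPrimitive {s c v : ℝ} (h0 : s ≠ 0) (h1 : 1 - 2 * s ≠ 0)
    (h2 : 2 - 2 * s ≠ 0) (hv : 0 < v) :
    HasDerivAt (kernelPrimitive s c) ((c - v) ^ 2 / v ^ (1 + 2 * s)) v := by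
  have hpow (p : ℝ) (hp : p ≠ 0) : HasDerivAt (fun v : ℝ => v ^ p / p) (v ^ (p - 1)) v := by
    have h := (Real.hasDerivAt_rpow_const (p := p) (Or.inl hv.ne')).div_const p
    rwa [mul_div_cancel_left₀ _ hp] at h
  have h := (((hpow (-(2 * s)) (by simpa using h0)).const_mul (c ^ 2)).sub
    ((hpow _ h1).const_mul (2 * c))).add (hpow _ h2)
  refine h.congr_deriv ?_
  have e1 : v ^ (1 - 2 * s - 1) = v * v ^ (-(2 * s) - 1) := by
    rw [← Real.rpow_one_add' hv.le (by ring_nf; simpa using h0)]; ring_nf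
  have e2 : v ^ (2 - 2 * s - 1) = v ^ 2 * v ^ (-(2 * s) - 1) := by
    rw [← Real.rpow_natCast, ← Real.rpow_add hv]; push_cast; ring_nf
  have e3 : v ^ (1 + 2 * s) = (v ^ (-(2 * s) - 1))⁻¹ := by
    rw [← Real.rpow_neg hv.le]; ring_nf
  rw [e1, e2, e3, div_inv_eq_mul]
  ring

lemma integral_kernel {s c p : ℝ} (h0 : s ≠ 0) (h1 : 1 - 2 * s ≠ 0) (h2 : 2 - 2 * s ≠ 0)
    (hp : 0 < p) :
    ∫ y in (0 : ℝ)..1, (c - (y + p)) ^ 2 / (y + p) ^ (1 + 2 * s) =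
      kernelPrimitive s c (1 + p) - kernelPrimitive s c p := by
  have hpos : ∀ y ∈ uIcc (0 : ℝ) 1, 0 < y + p := fun y hy => by
    rw [uIcc_of_le zero_le_one] at hy
    linarith [hy.1]
  have h := intervalIntegral.integral_eq_sub_of_hasDerivAt
    (f := fun y => kernelPrimitive s c (y + p))
    (f' := fun y => (c - (y + p)) ^ 2 / (y + p) ^ (1 + 2 * s)) (a := 0) (b := 1)
    (fun y hy => (hasDerivAt_kernelPrimitive h0 h1 h2 (hpos y hy)).comp_add_const y p)
    (ContinuousOn.intervalIntegrable (ContinuousOn.div (by fun_prop)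
      (ContinuousOn.rpow_const (by fun_prop) fun y hy => Or.inl (hpos y hy).ne')
      fun y hy => (Real.rpow_pos_of_pos (hpos y hy) _).ne'))
  simpa using h

/-- The rescaled inner integral `δ ^ (2 * s) * ∫ y in 0..1, (a - y) ^ 2 / (y + δ * a) ^ (1 + 2 * s)`,
in closed form and extended continuously to all `δ` and `a`. -/
def rescaledInner (s d a : ℝ) : ℝ :=
  (a * (1 + d)) ^ 2 * d ^ (2 * s) * (max 1 (1 + d * a) ^ (-(2 * s)) / (-(2 * s)))
    + (1 + d) ^ 2 * a ^ (2 - 2 * s) / (2 * s)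
    - 2 * (a * (1 + d)) * d ^ (2 * s) * (max 1 (1 + d * a) ^ (1 - 2 * s) / (1 - 2 * s))
    + 2 * (1 + d) * d * a ^ (2 - 2 * s) / (1 - 2 * s)
    + d ^ (2 * s) * max 1 (1 + d * a) ^ (2 - 2 * s) / (2 - 2 * s)
    - d ^ 2 * a ^ (2 - 2 * s) / (2 - 2 * s)

lemma continuous_rescaledInner {s : ℝ} (h0 : 0 ≤ s) (h1 : s ≤ 1) :
    Continuous (Function.uncurry (rescaledInner s)) := by
  have hd : Continuous fun z : ℝ × ℝ => z.1 ^ (2 * s) :=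
    continuous_fst.rpow_const fun _ => Or.inr (by linarith)
  have ha : Continuous fun z : ℝ × ℝ => z.2 ^ (2 - 2 * s) :=
    continuous_snd.rpow_const fun _ => Or.inr (by linarith)
  have hm (q : ℝ) : Continuous fun z : ℝ × ℝ => max 1 (1 + z.1 * z.2) ^ q :=
    Continuous.rpow_const (by fun_prop) fun z =>
      Or.inl (lt_of_lt_of_le one_pos (le_max_left _ _)).ne'
  have hm1 := hm (-(2 * s))
  have hm2 := hm (1 - 2 * s)
  have hm3 := hm (2 - 2 * s)
  unfold rescaledInner Function.uncurry
  fun_prop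

lemma rpow_mul_sub_kernelPrimitive {s d a : ℝ} (hd : 0 < d) (ha : 0 < a) :
    d ^ (2 * s) * (kernelPrimitive s (a * (1 + d)) (1 + d * a)
      - kernelPrimitive s (a * (1 + d)) (d * a)) = rescaledInner s d a := by
  have hmax : max 1 (1 + d * a) = 1 + d * a := max_eq_right (by nlinarith)
  have e2 : d ^ (2 - 2 * s) = d ^ 2 * (d ^ (2 * s))⁻¹ := by
    rw [Real.rpow_sub hd, Real.rpow_ofNat, div_eq_mul_inv]
  have e1 : d ^ (1 - 2 * s) = d * (d ^ (2 * s))⁻¹ := by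
    rw [Real.rpow_sub hd, Real.rpow_one, div_eq_mul_inv]
  have f2 : a ^ (2 - 2 * s) = a ^ 2 * (a ^ (2 * s))⁻¹ := by
    rw [Real.rpow_sub ha, Real.rpow_ofNat, div_eq_mul_inv]
  have f1 : a ^ (1 - 2 * s) = a * (a ^ (2 * s))⁻¹ := by
    rw [Real.rpow_sub ha, Real.rpow_one, div_eq_mul_inv]
  have hne : d ^ (2 * s) ≠ 0 := (Real.rpow_pos_of_pos hd _).ne'
  have hc : d ^ (2 * s) * (d ^ (2 * s))⁻¹ = 1 := mul_inv_cancel₀ hne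
  simp only [kernelPrimitive, rescaledInner, hmax, Real.mul_rpow hd.le ha.le, e1, e2, f1, f2,
    Real.rpow_neg hd.le, Real.rpow_neg ha.le, div_eq_mul_inv, inv_neg]
  generalize (1 + d * a) ^ (-(2 * s)) = m1
  generalize (1 + d * a) ^ (1 - 2 * s) = m2
  generalize (1 + d * a) ^ (2 - 2 * s) = m3
  generalize (d ^ (2 * s))⁻¹ = D' at *
  generalize d ^ (2 * s) = D at *
  generalize (a ^ (2 * s))⁻¹ = A
  generalize (2 * s)⁻¹ = i0
  generalize (1 - 2 * s)⁻¹ = i1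
  generalize (2 - 2 * s)⁻¹ = i2
  linear_combination ((a * (1 + d)) ^ 2 * A * i0 + 2 * (a * (1 + d)) * d * a * A * i1
    - d ^ 2 * a ^ 2 * A * i2) * hc

lemma rpow_mul_inner_integral {s d x : ℝ} (h0 : s ≠ 0) (h1 : 1 - 2 * s ≠ 0)
    (h2 : 2 - 2 * s ≠ 0) (hd : 0 < d) (hx : x ∈ Ioo (-d) 0) :
    d ^ (2 * s) * (∫ y in Ioo (0 : ℝ) 1,
      (ubar (1 / d) d x - ubar (1 / d) d y) ^ 2 / |x - y| ^ (1 + 2 * s)) =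
      rescaledInner s d (x / (-d)) := by
  have ha : 0 < x / (-d) := div_pos_of_neg_of_neg hx.2 (by linarith)
  have hda : d * (x / (-d)) = -x := by field_simp
  rw [← rpow_mul_sub_kernelPrimitive hd ha,
    ← integral_kernel h0 h1 h2 (mul_pos hd ha), intervalIntegral.integral_of_le zero_le_one,
    integral_Ioc_eq_integral_Ioo]
  congr 1
  refine setIntegral_congr_fun measurableSet_Ioo fun y hy => ?_
  have habs : |x - y| = y + d * (x / (-d)) := by
    rw [abs_of_neg (by linarith [hx.2, hy.1]), hda]; ring
  simp only [ubar_one_div_of_neg hd hx, ubar_one_div_of_pos hd hy, habs]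
  congr 2
  ring

lemma rescaled_double_integral {s d : ℝ} (h0 : s ≠ 0) (h1 : 1 - 2 * s ≠ 0)
    (h2 : 2 - 2 * s ≠ 0) (hd : 0 < d) :
    d ^ (2 * s - 1) * ((1 / 2) * ∫ x in Ioo (-d) (0 : ℝ), ∫ y in Ioo (0 : ℝ) 1,
      (ubar (1 / d) d x - ubar (1 / d) d y) ^ 2 / |x - y| ^ (1 + 2 * s)) =
      (1 / 2) * ∫ a in (0 : ℝ)..1, rescaledInner s d a := by
  have hscale : d ^ (2 * s) * (∫ x in Ioo (-d) (0 : ℝ), ∫ y in Ioo (0 : ℝ) 1,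
      (ubar (1 / d) d x - ubar (1 / d) d y) ^ 2 / |x - y| ^ (1 + 2 * s)) =
      d * ∫ a in (0 : ℝ)..1, rescaledInner s d a := by
    rw [← integral_const_mul, setIntegral_congr_fun measurableSet_Ioo
      fun x hx => rpow_mul_inner_integral h0 h1 h2 hd hx, ← integral_Ioc_eq_integral_Ioo,
      ← intervalIntegral.integral_of_le (by linarith),
      intervalIntegral.integral_comp_div _ (neg_ne_zero.2 hd.ne'), div_self (neg_ne_zero.2 hd.ne'),
      zero_div, intervalIntegral.integral_symm, smul_eq_mul, neg_mul_neg]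
  rw [Real.rpow_sub_one hd.ne', mul_left_comm, div_mul_eq_mul_div (d ^ (2 * s)), hscale,
    mul_div_cancel_left₀ _ hd.ne']

lemma integral_rescaledInner_zero {s : ℝ} (h0 : 0 < s) (h1 : s < 1) :
    ∫ a in (0 : ℝ)..1, rescaledInner s 0 a = 1 / (2 * s * (3 - 2 * s)) := by
  have hz : (0 : ℝ) ^ (2 * s) = 0 := Real.zero_rpow (by linarith)
  have hfun : rescaledInner s 0 = fun a => a ^ (2 - 2 * s) / (2 * s) := by
    ext a
    simp [rescaledInner, hz]
  have h3 : 2 - 2 * s + 1 = 3 - 2 * s := by ring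
  rw [hfun, intervalIntegral.integral_div, integral_rpow (Or.inl (by linarith)), h3,
    Real.one_rpow, Real.zero_rpow (by linarith), sub_zero, div_div, mul_comm (2 * s)]

/-- asymptotics of the interaction `𝓘ⁿ₂` for `1/2 < s < 1`. -/
theorem statement16 (s : ℝ) (hs : 1 / 2 < s) (hs1 : s < 1)
    (δ : ℕ → ℝ) (hδpos : ∀ n, 0 < δ n) (hδ0 : Tendsto δ atTop (𝓝 0)) :
    Tendsto (fun n => (δ n) ^ (2 * s - 1) *
        ((1 / 2) * ∫ x in Set.Ioo (-(δ n)) (0 : ℝ), ∫ y in Set.Ioo (0 : ℝ) 1,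
          (ubar (1 / δ n) (δ n) x - ubar (1 / δ n) (δ n) y) ^ 2 / |x - y| ^ (1 + 2 * s)))
      atTop (𝓝 (1 / (4 * s * (3 - 2 * s)))) := by
  have h0 : s ≠ 0 := by linarith
  have h1 : 1 - 2 * s ≠ 0 := by linarith
  have h2 : 2 - 2 * s ≠ 0 := by linarith
  simp only [rescaled_double_integral h0 h1 h2 (hδpos _)]
  have hcont : Continuous fun d => ∫ a in (0 : ℝ)..1, rescaledInner s d a :=
    intervalIntegral.continuous_parametric_intervalIntegral_of_continuous'
      (continuous_rescaledInner (by linarith) hs1.le) 0 1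
  have hlim := ((hcont.tendsto 0).comp hδ0).const_mul (1 / 2)
  rw [integral_rescaledInner_zero (by linarith) hs1, one_div_mul_one_div, ← mul_assoc,
    ← mul_assoc, show (2 : ℝ) * 2 = 4 by norm_num] at hlim
  exact hlim
end
end

section
/- Let Λ, δ > 0, T = L(Λ+1)δ for some positive integer L, and let u be a minimizer of ℱ^T_0 over 𝒜^{T,Λ,δ}. Then for every connected component (x₁, x₂) of the set where u' = −Λ, one has x₂ = x₁ + δ and u(x₂) = −u(x₁). -/
open MeasureTheory Filter Set Topology

noncomputable section

/-- A continuous function with constant derivative `m` on `(a, b)` is affine on `[a, b]`. -/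
theorem eq_affine_of_hasDerivAt_Ioo {u : ℝ → ℝ} (hu : Continuous u) {a b m : ℝ}
    (h : ∀ x ∈ Set.Ioo a b, HasDerivAt u m x) {x : ℝ} (hx : x ∈ Set.Icc a b) :
    u x = u a + m * (x - a) := by
  rcases eq_or_lt_of_le hx.1 with rfl | hax
  · simp
  · obtain ⟨c, -, hc⟩ := exists_hasDerivAt_eq_slope u (fun _ => m) hax hu.continuousOn
      (fun y hy => h y ⟨hy.1, hy.2.trans_le hx.2⟩)
    have : x - a ≠ 0 := by linarith
    rw [hc]
    field_simp
    ring

theorem countable_of_isolated {S : Set ℝ}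
    (hS : ∀ x ∈ S, ∃ ε > 0, S ∩ Set.Ioo (x - ε) (x + ε) ⊆ {x}) : S.Countable := by
  have : DiscreteTopology S := by
    rw [discreteTopology_subtype_iff]
    intro x hx
    obtain ⟨ε, hε, h⟩ := hS x hx
    rw [← Filter.empty_mem_iff_bot]
    have h1 : Set.Ioo (x - ε) (x + ε) ∈ 𝓝[≠] x :=
      mem_nhdsWithin_of_mem_nhds (Ioo_mem_nhds (by linarith) (by linarith))
    filter_upwards [Filter.inter_mem_inf (f := 𝓝[≠] x) (g := 𝓟 S) h1 (Filter.mem_principal_self S),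
      Filter.mem_inf_of_left (self_mem_nhdsWithin (a := x) (s := {x}ᶜ))] with y hy hne
    exact hne (h ⟨hy.2, hy.1⟩)
  exact Set.countable_coe_iff.mp (TopologicalSpace.separableSpace_iff_countable.mp inferInstance)

/-- Off a countable set, an admissible function is differentiable with slope `1` or `-Λ`. -/
theorem Admissible.exists_countable_slopes {T Λ δ : ℝ} {u : ℝ → ℝ} (hu : Admissible T Λ δ u) :
    ∃ S : Set ℝ, S.Countable ∧ ∀ x ∉ S, HasDerivAt u 1 x ∨ HasDerivAt u (-Λ) x := by
  obtain ⟨S, -, hS, haff⟩ := hu.pwAffine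
  refine ⟨S, countable_of_isolated hS, fun x hx => ?_⟩
  obtain ⟨ε, hε, m, q, hm⟩ := haff x hx
  have hder : ∀ y ∈ Metric.ball x ε, HasDerivAt u m y := by
    intro y hy
    have h1 : HasDerivAt (fun z : ℝ => m * z + q) m y := by
      simpa using ((hasDerivAt_id y).const_mul m).add_const q
    refine h1.congr_of_eventuallyEq ?_
    filter_upwards [Metric.isOpen_ball.mem_nhds hy] with z hz
    exact hm z (by simpa [Real.dist_eq] using hz)
  obtain ⟨y, hy, hys⟩ : ∃ y ∈ Metric.ball x ε, HasDerivAt u 1 y ∨ HasDerivAt u (-Λ) y := by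
    have hd := Measure.dense_of_ae hu.slopes
    obtain ⟨y, hy1, hy2⟩ := hd.exists_mem_open Metric.isOpen_ball ⟨x, Metric.mem_ball_self hε⟩
    exact ⟨y, hy2, hy1⟩
  have hxd := hder x (Metric.mem_ball_self hε)
  rcases hys with h | h
  · left; rwa [(hder y hy).unique h] at hxd
  · right; rwa [(hder y hy).unique h] at hxd

theorem measurableSet_hasDerivAt {u : ℝ → ℝ} {m : ℝ} (hm : m ≠ 0) :
    MeasurableSet {x : ℝ | HasDerivAt u m x} := by
  have : {x : ℝ | HasDerivAt u m x} = deriv u ⁻¹' {m} := by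
    ext x
    refine ⟨fun h => h.deriv, fun h => ?_⟩
    have h' : deriv u x = m := h
    have hd : DifferentiableAt ℝ u x := differentiableAt_of_deriv_ne_zero (by rw [h']; exact hm)
    simpa [h'] using hd.hasDerivAt
  rw [this]
  exact measurable_deriv u (measurableSet_singleton m)

theorem Function.Periodic.hasDerivAt_of_add {u : ℝ → ℝ} {T m x : ℝ} (hu : Function.Periodic u T)
    (h : HasDerivAt u m (x + T)) : HasDerivAt u m x := by
  have h1 := HasDerivAt.comp_add_const x T h
  rwa [show (fun x => u (x + T)) = u from funext hu] at h1

/-- Since `∫ u' (u² - κ) = 0` over a period, the integral of `u² - κ` over a period is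
proportional to its integral over the region of slope `-Λ`. -/
theorem Admissible.integral_sq_sub_eq {T Λ δ : ℝ} {u : ℝ → ℝ} (hu : Admissible T Λ δ u)
    (hΛ : 0 < Λ) (hT : 0 < T) (κ c : ℝ) :
    ∫ x in (0 : ℝ)..T, (u x ^ 2 - κ) =
      (1 + Λ) * ∫ x in {x : ℝ | HasDerivAt u (-Λ) x} ∩ Set.Ioc c (c + T), (u x ^ 2 - κ) := by
  set N : Set ℝ := {x : ℝ | HasDerivAt u (-Λ) x} with hN
  have hNm : MeasurableSet N := measurableSet_hasDerivAt (by linarith)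
  obtain ⟨S, hSc, hS⟩ := hu.exists_countable_slopes
  have hg : Continuous fun x => u x ^ 2 - κ := (hu.cont.pow 2).sub continuous_const
  have hgi : IntervalIntegrable (fun x => u x ^ 2 - κ) volume c (c + T) :=
    hg.intervalIntegrable _ _
  have hNi : IntervalIntegrable (N.indicator fun x => u x ^ 2 - κ) volume c (c + T) := by
    rw [intervalIntegrable_iff] at hgi ⊢
    exact hgi.indicator hNm
  have hgper : Function.Periodic (fun x => u x ^ 2 - κ) T := fun x => by simp only [hu.per x]
  have hshift : ∫ x in (0 : ℝ)..T, (u x ^ 2 - κ) = ∫ x in c..(c + T), (u x ^ 2 - κ) := by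
    simpa using hgper.intervalIntegral_add_eq 0 c
  have hftc : ∫ x in c..(c + T),
      ((u x ^ 2 - κ) - (1 + Λ) * N.indicator (fun x => u x ^ 2 - κ) x) = 0 := by
    rw [MeasureTheory.integral_eq_of_hasDerivAt_off_countable
      (fun x => u x ^ 3 / 3 - κ * u x) _ hSc
      (((hu.cont.pow 3).div_const 3).sub (continuous_const.mul hu.cont)).continuousOn
      ?_ (hgi.sub (hNi.const_mul _))]
    · simp only [hu.per c, sub_self]
    · rintro x ⟨-, hx⟩
      by_cases hxN : x ∈ N
      · have hd : HasDerivAt u (-Λ) x := hxN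
        rw [Set.indicator_of_mem hxN]
        refine (((hd.pow 3).div_const 3).sub (hd.const_mul κ)).congr_deriv ?_
        push_cast
        ring
      · have hd : HasDerivAt u 1 x := (hS x hx).resolve_right hxN
        rw [Set.indicator_of_notMem hxN]
        refine (((hd.pow 3).div_const 3).sub (hd.const_mul κ)).congr_deriv ?_
        push_cast
        ring
  rw [intervalIntegral.integral_sub hgi (hNi.const_mul _),
    intervalIntegral.integral_const_mul,
    intervalIntegral.integral_of_le (f := N.indicator _) (by linarith),
    integral_indicator hNm, Measure.restrict_restrict hNm] at hftc
  linarith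

theorem integral_Ioo_sq_sub {u : ℝ → ℝ} (hu : Continuous u) {Λ δ a : ℝ} (hδ : 0 < δ)
    (h : Set.Ioo a (a + δ) ⊆ {x : ℝ | HasDerivAt u (-Λ) x}) :
    ∫ x in Set.Ioo a (a + δ), (u x ^ 2 - (Λ * δ) ^ 2 / 12) = δ * (u a - Λ * δ / 2) ^ 2 := by
  have h1 : ∫ x in Set.Ioo a (a + δ), (u x ^ 2 - (Λ * δ) ^ 2 / 12) =
      ∫ x in Set.Ioo a (a + δ), ((u a + -Λ * (x - a)) ^ 2 - (Λ * δ) ^ 2 / 12) := by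
    refine setIntegral_congr_fun measurableSet_Ioo fun x hx => ?_
    rw [eq_affine_of_hasDerivAt_Ioo hu (fun y hy => h hy) (Set.Ioo_subset_Icc_self hx)]
  rw [h1, ← integral_Ioc_eq_integral_Ioo, ← intervalIntegral.integral_of_le (by linarith),
    intervalIntegral.integral_comp_sub_right
      (fun t => (u a + -Λ * t) ^ 2 - (Λ * δ) ^ 2 / 12) a]
  have h2 : ∀ t ∈ Set.uIcc (a - a) (a + δ - a), HasDerivAt
      (fun t : ℝ => u a ^ 2 * t - u a * Λ * t ^ 2 + Λ ^ 2 * t ^ 3 / 3 - (Λ * δ) ^ 2 / 12 * t)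
      ((u a + -Λ * t) ^ 2 - (Λ * δ) ^ 2 / 12) t := by
    intro t _
    have hid := hasDerivAt_id t
    refine ((((hid.const_mul (u a ^ 2)).sub ((hid.pow 2).const_mul (u a * Λ))).add
      (((hid.pow 3).const_mul (Λ ^ 2)).div_const 3)).sub
      (hid.const_mul ((Λ * δ) ^ 2 / 12))).congr_deriv ?_
    simp only [id]
    push_cast
    ring
  rw [intervalIntegral.integral_eq_sub_of_hasDerivAt h2
    (Continuous.intervalIntegrable (by fun_prop) _ _)]
  ring

/-- The energy excess of an admissible function is a sum of nonnegative contributions, one for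
each interval of slope `-Λ` in a period. -/
theorem Admissible.hasSum_excess {T Λ δ : ℝ} {u : ℝ → ℝ} (hu : Admissible T Λ δ u)
    (hΛ : 0 < Λ) (hδ : 0 < δ) (hT : 0 < T) {a : ℕ → ℝ}
    (ha : ∀ k : ℕ, Set.Ioo (a k) (a k + δ) ⊆ {x : ℝ | HasDerivAt u (-Λ) x})
    (hcov : {x : ℝ | HasDerivAt u (-Λ) x} ⊆ ⋃ k : ℕ, Set.Icc (a k) (a k + δ))
    (hdisj : Pairwise fun i j : ℕ =>
      (Set.Icc (a i) (a i + δ) ∩ Set.Icc (a j) (a j + δ)).Subsingleton)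
    {c : ℝ} (hc : ¬ HasDerivAt u (-Λ) c) :
    HasSum (fun k => (1 + Λ) *
        (if a k ∈ Set.Ico c (c + T) then δ * (u (a k) - Λ * δ / 2) ^ 2 else 0))
      (∫ x in (0 : ℝ)..T, (u x ^ 2 - (Λ * δ) ^ 2 / 12)) := by
  have hcT : ¬ HasDerivAt u (-Λ) (c + T) := fun h => hc (hu.per.hasDerivAt_of_add h)
  rw [hu.integral_sq_sub_eq hΛ hT _ c]
  refine HasSum.mul_left _ ?_
  have hg : Continuous fun x => u x ^ 2 - (Λ * δ) ^ 2 / 12 := (hu.cont.pow 2).sub continuous_const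
  have hae : ({x : ℝ | HasDerivAt u (-Λ) x} ∩ Set.Ioc c (c + T) : Set ℝ) =ᵐ[volume]
      (⋃ k, Set.Ioo (a k) (a k + δ) ∩ Set.Ioc c (c + T) : Set ℝ) := by
    have hcount : (Set.range a ∪ Set.range fun k => a k + δ).Countable :=
      (Set.countable_range _).union (Set.countable_range _)
    rw [Filter.eventuallyEq_set]
    filter_upwards [hcount.ae_notMem volume] with x hx
    simp only [Set.mem_union, Set.mem_range, not_or, not_exists] at hx
    rw [← Set.iUnion_inter]
    refine and_congr_left fun _ => ⟨fun h => ?_, fun h => ?_⟩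
    · obtain ⟨k, hk⟩ := Set.mem_iUnion.1 (hcov h)
      exact Set.mem_iUnion.2 ⟨k, lt_of_le_of_ne hk.1 (hx.1 k),
        lt_of_le_of_ne hk.2 (Ne.symm (hx.2 k))⟩
    · obtain ⟨k, hk⟩ := Set.mem_iUnion.1 h
      exact ha k hk
  rw [setIntegral_congr_set hae]
  have hsum := hasSum_integral_iUnion (μ := volume) (f := fun x => u x ^ 2 - (Λ * δ) ^ 2 / 12)
    (s := fun k => Set.Ioo (a k) (a k + δ) ∩ Set.Ioc c (c + T))
    (fun k => measurableSet_Ioo.inter measurableSet_Ioc) ?_ ?_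
  · refine (congrArg (HasSum · _) (funext fun k => ?_)).mpr hsum
    have hck : ¬ (a k < c ∧ c < a k + δ) := fun h => hc (ha k h)
    have hcTk : ¬ (a k < c + T ∧ c + T < a k + δ) := fun h => hcT (ha k h)
    split_ifs with hk
    · have hle : a k + δ ≤ c + T := by
        by_contra! h
        exact hcTk ⟨hk.2, h⟩
      have hsub : Set.Ioo (a k) (a k + δ) ⊆ Set.Ioc c (c + T) :=
        fun x hx => ⟨hk.1.trans_lt hx.1, hx.2.le.trans hle⟩
      rw [Set.inter_eq_left.2 hsub, integral_Ioo_sq_sub hu.cont hδ (ha k)]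
    · have hempty : Set.Ioo (a k) (a k + δ) ∩ Set.Ioc c (c + T) = ∅ := by
        rw [Set.eq_empty_iff_forall_notMem]
        rintro x ⟨hx1, hx2⟩
        have h1 : c ≤ a k := by
          by_contra! h
          exact hck ⟨h, hx2.1.trans hx1.2⟩
        exact hk ⟨h1, hx1.1.trans_le hx2.2⟩
      simp [hempty]
  · intro i j hij
    refine Set.disjoint_left.2 ?_
    rintro x ⟨hxi, -⟩ ⟨hxj, -⟩
    obtain ⟨y, hxy, hy⟩ := exists_between (lt_min hxi.2 hxj.2)
    have hy' := lt_min_iff.1 hy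
    exact hxy.ne (hdisj hij ⟨⟨hxi.1.le, hxi.2.le⟩, ⟨hxj.1.le, hxj.2.le⟩⟩
      ⟨⟨(hxi.1.trans hxy).le, hy'.1.le⟩, ⟨(hxj.1.trans hxy).le, hy'.2.le⟩⟩)
  · exact (hg.integrableOn_Ioc (a := c) (b := c + T)).mono_set
      (Set.iUnion_subset fun k => Set.inter_subset_right)

/-- In every period there is a point where the derivative is not `-Λ`. -/
theorem Function.Periodic.exists_not_hasDerivAt {u : ℝ → ℝ} {T m : ℝ}
    (hper : Function.Periodic u T) (hu : Continuous u) (hT : 0 < T) (hm : m ≠ 0) (b : ℝ) :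
    ∃ c ∈ Set.Ioo (b - T) b, ¬ HasDerivAt u m c := by
  obtain ⟨c, hc, hd⟩ := exists_deriv_eq_zero (f := u) (a := b - T) (b := b) (by linarith)
    hu.continuousOn (by rw [← hper (b - T)]; simp)
  exact ⟨c, hc, fun h => hm (by rw [← h.deriv, hd])⟩

theorem Admissible.F0_eq {T Λ δ : ℝ} {u : ℝ → ℝ} (hu : Admissible T Λ δ u) (hT : 0 < T) (κ : ℝ) :
    F0 T u = 1 / (2 * T) * ((∫ x in (0 : ℝ)..T, (u x ^ 2 - κ)) + T * κ) := by
  have h : ∫ x in (0 : ℝ)..T, (u x ^ 2 - κ) = (∫ x in (0 : ℝ)..T, u x ^ 2) - T * κ := by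
    have hi : Continuous fun x => u x ^ 2 := hu.cont.pow 2
    rw [intervalIntegral.integral_sub (hi.intervalIntegrable _ _) intervalIntegrable_const]
    simp
  rw [h, F0, ← integral_Ioc_eq_integral_Ioo, ← intervalIntegral.integral_of_le hT.le]
  ring

/-- The balanced sawtooth: a translate of `ubar Λ δ - Λ * δ / 2`. -/
def balancedSawtooth (Λ δ x : ℝ) : ℝ :=
  max (-Λ * ((Λ + 1) * δ * Int.fract (x / ((Λ + 1) * δ)) - δ))
    ((Λ + 1) * δ * Int.fract (x / ((Λ + 1) * δ)) - δ) - Λ * δ / 2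

section Sawtooth

variable {Λ δ : ℝ}

theorem mul_fract_div {p x : ℝ} (hp : 0 < p) {n : ℤ}
    (hx : x ∈ Set.Ico (n * p) (n * p + p)) : p * Int.fract (x / p) = x - n * p := by
  have : ⌊x / p⌋ = n := by
    rw [Int.floor_eq_iff, le_div_iff₀ hp, div_lt_iff₀ hp]
    exact ⟨hx.1, by linarith [hx.2]⟩
  rw [Int.fract, this]
  field_simp

theorem exists_mem_Ico_int_mul {p : ℝ} (hp : 0 < p) (x : ℝ) :
    ∃ n : ℤ, x ∈ Set.Ico (n * p) (n * p + p) := by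
  refine ⟨⌊x / p⌋, ?_, ?_⟩
  · rw [← le_div_iff₀ hp]
    exact Int.floor_le _
  · have := (div_lt_iff₀ hp).1 (Int.lt_floor_add_one (x / p))
    linarith

theorem balancedSawtooth_eq_down (hΛ : 0 < Λ) (hδ : 0 < δ) {n : ℤ} {x : ℝ}
    (hx : x ∈ Set.Icc (n * ((Λ + 1) * δ)) (n * ((Λ + 1) * δ) + δ)) :
    balancedSawtooth Λ δ x = -Λ * x + (Λ * (n * ((Λ + 1) * δ) + δ) - Λ * δ / 2) := by
  have hp : 0 < Λ * δ := by positivity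
  rw [balancedSawtooth, mul_fract_div (by positivity) (n := n) ⟨hx.1, by linarith [hx.2]⟩,
    max_eq_left]
  · ring
  · nlinarith [hx.2]

theorem balancedSawtooth_eq_up (hΛ : 0 < Λ) (hδ : 0 < δ) {n : ℤ} {x : ℝ}
    (hx : x ∈ Set.Ico (n * ((Λ + 1) * δ) + δ) (n * ((Λ + 1) * δ) + (Λ + 1) * δ)) :
    balancedSawtooth Λ δ x = 1 * x + (-(n * ((Λ + 1) * δ) + δ) - Λ * δ / 2) := by
  rw [balancedSawtooth, mul_fract_div (by positivity) (n := n) ⟨by linarith [hx.1], hx.2⟩,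
    max_eq_right]
  · ring
  · nlinarith [hx.1]

theorem hasDerivAt_of_eq_affine_Ioo {u : ℝ → ℝ} {a b m q x : ℝ}
    (h : ∀ y ∈ Set.Ioo a b, u y = m * y + q) (hx : x ∈ Set.Ioo a b) : HasDerivAt u m x := by
  have h1 : HasDerivAt (fun z : ℝ => m * z + q) m x := by
    simpa using ((hasDerivAt_id x).const_mul m).add_const q
  refine h1.congr_of_eventuallyEq ?_
  filter_upwards [isOpen_Ioo.mem_nhds hx] with z hz using h z hz

theorem hasDerivAt_balancedSawtooth_down (hΛ : 0 < Λ) (hδ : 0 < δ) {n : ℤ} {x : ℝ}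
    (hx : x ∈ Set.Ioo (n * ((Λ + 1) * δ)) (n * ((Λ + 1) * δ) + δ)) :
    HasDerivAt (balancedSawtooth Λ δ) (-Λ) x :=
  hasDerivAt_of_eq_affine_Ioo
    (fun _ hy => balancedSawtooth_eq_down hΛ hδ (Set.Ioo_subset_Icc_self hy)) hx

theorem hasDerivAt_balancedSawtooth_up (hΛ : 0 < Λ) (hδ : 0 < δ) {n : ℤ} {x : ℝ}
    (hx : x ∈ Set.Ioo (n * ((Λ + 1) * δ) + δ) (n * ((Λ + 1) * δ) + (Λ + 1) * δ)) :
    HasDerivAt (balancedSawtooth Λ δ) 1 x :=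
  hasDerivAt_of_eq_affine_Ioo
    (fun _ hy => balancedSawtooth_eq_up hΛ hδ (Set.Ioo_subset_Ico_self hy)) hx

theorem continuous_balancedSawtooth (hΛ : 0 < Λ) (hδ : 0 < δ) :
    Continuous (balancedSawtooth Λ δ) := by
  have h : Continuous ((fun t : ℝ => max (-Λ * ((Λ + 1) * δ * t - δ)) ((Λ + 1) * δ * t - δ)
      - Λ * δ / 2) ∘ Int.fract) := by
    refine ContinuousOn.comp_fract'' (Continuous.continuousOn (by fun_prop)) ?_
    have hp : 0 < Λ * δ := by positivity
    rw [max_eq_left (by nlinarith), max_eq_right (by nlinarith)]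
    ring
  exact h.comp (continuous_id.div_const ((Λ + 1) * δ))

theorem periodic_balancedSawtooth (hΛ : 0 < Λ) (hδ : 0 < δ) :
    Function.Periodic (balancedSawtooth Λ δ) ((Λ + 1) * δ) := by
  intro x
  have hp : (Λ + 1) * δ ≠ 0 := by positivity
  simp only [balancedSawtooth, add_div, div_self hp, Int.fract_add_one]

/-- The corners of the balanced sawtooth. -/
def sawtoothCorners (Λ δ : ℝ) : Set ℝ :=
  {x | ∃ n : ℤ, x = n * ((Λ + 1) * δ) ∨ x = n * ((Λ + 1) * δ) + δ}

theorem exists_mem_Ioo_of_notMem_sawtoothCorners (hΛ : 0 < Λ) (hδ : 0 < δ) {x : ℝ}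
    (hx : x ∉ sawtoothCorners Λ δ) :
    ∃ n : ℤ, x ∈ Set.Ioo (n * ((Λ + 1) * δ)) (n * ((Λ + 1) * δ) + δ) ∨
      x ∈ Set.Ioo (n * ((Λ + 1) * δ) + δ) (n * ((Λ + 1) * δ) + (Λ + 1) * δ) := by
  obtain ⟨n, hn⟩ := exists_mem_Ico_int_mul (p := (Λ + 1) * δ) (by positivity) x
  simp only [sawtoothCorners, Set.mem_ofPred_eq, not_exists, not_or] at hx
  refine ⟨n, ?_⟩
  rcases lt_or_gt_of_ne (hx n).2 with h | h
  · exact Or.inl ⟨lt_of_le_of_ne hn.1 (Ne.symm (hx n).1), h⟩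
  · exact Or.inr ⟨h, hn.2⟩

theorem sawtoothCorners_isolated (hΛ : 0 < Λ) (hδ : 0 < δ) {x y : ℝ}
    (hx : x ∈ sawtoothCorners Λ δ) (hy : y ∈ sawtoothCorners Λ δ)
    (h : |y - x| < min δ (Λ * δ)) : y = x := by
  obtain ⟨h1, h2⟩ := lt_min_iff.1 h
  rw [abs_lt] at h1 h2
  obtain ⟨n, hn⟩ := hx
  obtain ⟨m, hm⟩ := hy
  have hp : 0 < Λ * δ := by positivity
  have hmn : m = n ∨ (m : ℝ) + 1 ≤ n ∨ (n : ℝ) + 1 ≤ m := by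
    rcases lt_trichotomy m n with h | h | h
    · exact Or.inr (Or.inl (by exact_mod_cast h))
    · exact Or.inl h
    · exact Or.inr (Or.inr (by exact_mod_cast h))
  rcases hmn with rfl | h | h
  · rcases hn with rfl | rfl <;> rcases hm with rfl | rfl <;> linarith
  · have := mul_le_mul_of_nonneg_right h (by positivity : 0 ≤ (Λ + 1) * δ)
    rcases hn with rfl | rfl <;> rcases hm with rfl | rfl <;> linarith
  · have := mul_le_mul_of_nonneg_right h (by positivity : 0 ≤ (Λ + 1) * δ)
    rcases hn with rfl | rfl <;> rcases hm with rfl | rfl <;> linarith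

theorem sawtoothCorners_exists_isolating (hΛ : 0 < Λ) (hδ : 0 < δ) :
    ∀ x ∈ sawtoothCorners Λ δ, ∃ ε > 0,
      sawtoothCorners Λ δ ∩ Set.Ioo (x - ε) (x + ε) ⊆ {x} := by
  refine fun x hx => ⟨min δ (Λ * δ), lt_min hδ (by positivity), ?_⟩
  rintro y ⟨hy, hy1, hy2⟩
  exact sawtoothCorners_isolated hΛ hδ hx hy (abs_lt.2 ⟨by linarith, by linarith⟩)

theorem isClosed_sawtoothCorners (hΛ : 0 < Λ) (hδ : 0 < δ) : IsClosed (sawtoothCorners Λ δ) := by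
  refine Metric.isClosed_of_pairwise_le_dist (ε := min δ (Λ * δ)) (lt_min hδ (by positivity)) ?_
  intro x hx y hy hxy
  by_contra! h
  exact hxy (sawtoothCorners_isolated hΛ hδ hy hx h)

theorem piecewiseAffine_balancedSawtooth (hΛ : 0 < Λ) (hδ : 0 < δ) :
    PiecewiseAffine (balancedSawtooth Λ δ) := by
  refine ⟨sawtoothCorners Λ δ, isClosed_sawtoothCorners hΛ hδ,
    sawtoothCorners_exists_isolating hΛ hδ, fun x hx => ?_⟩
  obtain ⟨n, h | h⟩ := exists_mem_Ioo_of_notMem_sawtoothCorners hΛ hδ hx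
  · obtain ⟨ε, hε, hb⟩ := Metric.isOpen_iff.1 isOpen_Ioo x h
    exact ⟨ε, hε, _, _, fun y hy =>
      balancedSawtooth_eq_down hΛ hδ (Set.Ioo_subset_Icc_self (hb hy))⟩
  · obtain ⟨ε, hε, hb⟩ := Metric.isOpen_iff.1 isOpen_Ioo x h
    exact ⟨ε, hε, _, _, fun y hy =>
      balancedSawtooth_eq_up hΛ hδ (Set.Ioo_subset_Ico_self (hb hy))⟩

/-- The left endpoints of the descending intervals of the balanced sawtooth. -/
def sawtoothStart (Λ δ : ℝ) (k : ℕ) : ℝ :=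
  (Equiv.intEquivNat.symm k : ℝ) * ((Λ + 1) * δ)

theorem Ioo_sawtoothStart_subset (hΛ : 0 < Λ) (hδ : 0 < δ) (k : ℕ) :
    Set.Ioo (sawtoothStart Λ δ k) (sawtoothStart Λ δ k + δ) ⊆
      {x : ℝ | HasDerivAt (balancedSawtooth Λ δ) (-Λ) x} :=
  fun _ hx => hasDerivAt_balancedSawtooth_down hΛ hδ hx

theorem subset_iUnion_Icc_sawtoothStart (hΛ : 0 < Λ) (hδ : 0 < δ) :
    {x : ℝ | HasDerivAt (balancedSawtooth Λ δ) (-Λ) x} ⊆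
      ⋃ k : ℕ, Set.Icc (sawtoothStart Λ δ k) (sawtoothStart Λ δ k + δ) := by
  intro x hx
  obtain ⟨n, hn⟩ := exists_mem_Ico_int_mul (p := (Λ + 1) * δ) (by positivity) x
  refine Set.mem_iUnion.2 ⟨Equiv.intEquivNat n, ?_⟩
  simp only [sawtoothStart, Equiv.symm_apply_apply]
  refine ⟨hn.1, ?_⟩
  by_contra! h
  have := (hasDerivAt_balancedSawtooth_up hΛ hδ ⟨h, hn.2⟩).unique hx
  linarith

theorem pairwise_Icc_sawtoothStart (hΛ : 0 < Λ) (hδ : 0 < δ) :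
    Pairwise fun i j : ℕ =>
      (Set.Icc (sawtoothStart Λ δ i) (sawtoothStart Λ δ i + δ) ∩
        Set.Icc (sawtoothStart Λ δ j) (sawtoothStart Λ δ j + δ)).Subsingleton := by
  rintro i j hij x ⟨⟨hi1, hi2⟩, ⟨hj1, hj2⟩⟩
  exfalso
  have hp : 0 < Λ * δ := by positivity
  unfold sawtoothStart at hi1 hi2 hj1 hj2
  rcases lt_or_gt_of_ne (Equiv.intEquivNat.symm.injective.ne hij) with h | h
  · have h' : ((Equiv.intEquivNat.symm i : ℤ) : ℝ) + 1 ≤ (Equiv.intEquivNat.symm j : ℤ) := by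
      exact_mod_cast h
    have := mul_le_mul_of_nonneg_right h' (by positivity : 0 ≤ (Λ + 1) * δ)
    linarith
  · have h' : ((Equiv.intEquivNat.symm j : ℤ) : ℝ) + 1 ≤ (Equiv.intEquivNat.symm i : ℤ) := by
      exact_mod_cast h
    have := mul_le_mul_of_nonneg_right h' (by positivity : 0 ≤ (Λ + 1) * δ)
    linarith

theorem admissible_balancedSawtooth (hΛ : 0 < Λ) (hδ : 0 < δ) (L : ℕ) :
    Admissible (L * ((Λ + 1) * δ)) Λ δ (balancedSawtooth Λ δ) where
  cont := continuous_balancedSawtooth hΛ hδ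
  per := (periodic_balancedSawtooth hΛ hδ).nat_mul L
  pwAffine := piecewiseAffine_balancedSawtooth hΛ hδ
  slopes := by
    filter_upwards [(countable_of_isolated
      (sawtoothCorners_exists_isolating hΛ hδ)).ae_notMem volume] with x hx
    obtain ⟨n, h | h⟩ := exists_mem_Ioo_of_notMem_sawtoothCorners hΛ hδ hx
    · exact Or.inr (hasDerivAt_balancedSawtooth_down hΛ hδ h)
    · exact Or.inl (hasDerivAt_balancedSawtooth_up hΛ hδ h)
  negRegion := ⟨sawtoothStart Λ δ, Ioo_sawtoothStart_subset hΛ hδ,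
    subset_iUnion_Icc_sawtoothStart hΛ hδ, pairwise_Icc_sawtoothStart hΛ hδ⟩

theorem integral_balancedSawtooth_excess (hΛ : 0 < Λ) (hδ : 0 < δ) {L : ℕ} (hL : 0 < L) :
    ∫ x in (0 : ℝ)..(L * ((Λ + 1) * δ)),
      (balancedSawtooth Λ δ x ^ 2 - (Λ * δ) ^ 2 / 12) = 0 := by
  have hT : (0 : ℝ) < L * ((Λ + 1) * δ) := by positivity
  have hv := admissible_balancedSawtooth hΛ hδ L
  obtain ⟨c, -, hc⟩ :=
    hv.per.exists_not_hasDerivAt hv.cont hT (m := -Λ) (by linarith) 0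
  have hsum := hv.hasSum_excess hΛ hδ hT (Ioo_sawtoothStart_subset hΛ hδ)
    (subset_iUnion_Icc_sawtoothStart hΛ hδ) (pairwise_Icc_sawtoothStart hΛ hδ) hc
  refine hsum.unique ?_
  convert hasSum_zero with k
  have : balancedSawtooth Λ δ (sawtoothStart Λ δ k) = Λ * δ / 2 := by
    rw [sawtoothStart, balancedSawtooth_eq_down hΛ hδ (Set.left_mem_Icc.2 (by linarith))]
    ring
  simp [this]

end Sawtooth

/-- Every descending interval of a minimizer starts at height `Λ * δ / 2`. -/
theorem Admissible.apply_start_eq_of_isMin {T Λ δ : ℝ} {L : ℕ} {u : ℝ → ℝ}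
    (hu : Admissible T Λ δ u) (hΛ : 0 < Λ) (hδ : 0 < δ) (hL : 0 < L)
    (hT : T = (L : ℝ) * ((Λ + 1) * δ))
    (hmin : ∀ v : ℝ → ℝ, Admissible T Λ δ v → F0 T u ≤ F0 T v) {a : ℕ → ℝ}
    (ha : ∀ k : ℕ, Set.Ioo (a k) (a k + δ) ⊆ {x : ℝ | HasDerivAt u (-Λ) x})
    (hcov : {x : ℝ | HasDerivAt u (-Λ) x} ⊆ ⋃ k : ℕ, Set.Icc (a k) (a k + δ))
    (hdisj : Pairwise fun i j : ℕ =>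
      (Set.Icc (a i) (a i + δ) ∩ Set.Icc (a j) (a j + δ)).Subsingleton) (k : ℕ) :
    u (a k) = Λ * δ / 2 := by
  have hT0 : 0 < T := by rw [hT]; positivity
  have hv : Admissible T Λ δ (balancedSawtooth Λ δ) := hT ▸ admissible_balancedSawtooth hΛ hδ L
  have hle := hmin _ hv
  rw [hu.F0_eq hT0 ((Λ * δ) ^ 2 / 12), hv.F0_eq hT0 ((Λ * δ) ^ 2 / 12),
    show ∫ x in (0 : ℝ)..T, (balancedSawtooth Λ δ x ^ 2 - (Λ * δ) ^ 2 / 12) = 0 by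
      rw [hT]; exact integral_balancedSawtooth_excess hΛ hδ hL,
    mul_le_mul_iff_right₀ (by positivity)] at hle
  obtain ⟨c, hck, hc⟩ :=
    hu.per.exists_not_hasDerivAt hu.cont hT0 (m := -Λ) (by linarith) (a k)
  have hsum := hu.hasSum_excess hΛ hδ hT0 ha hcov hdisj hc
  have hk := le_hasSum hsum k fun j _ => by split_ifs <;> positivity
  rw [if_pos ⟨hck.2.le, by linarith [hck.1]⟩] at hk
  have hsq : (u (a k) - Λ * δ / 2) ^ 2 ≤ 0 := by
    by_contra! h
    have : 0 < (1 + Λ) * (δ * (u (a k) - Λ * δ / 2) ^ 2) := by positivity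
    linarith
  linarith [pow_eq_zero_iff (two_ne_zero) |>.1 (le_antisymm hsq (sq_nonneg _))]

/-- for a minimizer of `ℱ^T_0`, every connected component `(x₁,x₂)` of the
set where `u' = -Λ` satisfies `x₂ = x₁ + δ` and `u(x₂) = -u(x₁)`. -/
theorem statement18 (Λ δ T : ℝ) (L : ℕ)
    (hΛ : 0 < Λ) (hδ : 0 < δ) (hL : 0 < L)
    (hT : T = (L : ℝ) * ((Λ + 1) * δ))
    (u : ℝ → ℝ) (hu : Admissible T Λ δ u)
    (hmin : ∀ v : ℝ → ℝ, Admissible T Λ δ v → F0 T u ≤ F0 T v)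
    (x₁ x₂ : ℝ) (hx : x₁ < x₂)
    (hsub : Set.Ioo x₁ x₂ ⊆ {x : ℝ | HasDerivAt u (-Λ) x})
    (hmax : ∀ y₁ y₂ : ℝ, y₁ < y₂ → Set.Ioo y₁ y₂ ⊆ {x : ℝ | HasDerivAt u (-Λ) x} →
      Set.Ioo x₁ x₂ ⊆ Set.Ioo y₁ y₂ → y₁ = x₁ ∧ y₂ = x₂) :
    x₂ = x₁ + δ ∧ u x₂ = -u x₁ := by
  obtain ⟨a, ha, hcov, hdisj⟩ := hu.negRegion
  have hstart := hu.apply_start_eq_of_isMin hΛ hδ hL hT hmin ha hcov hdisj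
  have htile : ∀ k, ∀ x ∈ Set.Icc (a k) (a k + δ), u x = Λ * δ / 2 + -Λ * (x - a k) :=
    fun k x hx => by rw [eq_affine_of_hasDerivAt_Ioo hu.cont (fun y hy => ha k hy) hx, hstart k]
  have hbound : ∀ x, HasDerivAt u (-Λ) x → |u x| ≤ Λ * δ / 2 := by
    intro x hxd
    obtain ⟨k, hk⟩ := Set.mem_iUnion.1 (hcov hxd)
    rw [htile k x hk, abs_le]
    constructor <;> nlinarith [hk.1, hk.2]
  obtain ⟨y, hy1, hy2⟩ := exists_between hx
  obtain ⟨k, hk⟩ := Set.mem_iUnion.1 (hcov (hsub ⟨hy1, hy2⟩))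
  obtain ⟨h1, h2⟩ := hmax (min x₁ (a k)) (max x₂ (a k + δ))
    ((min_le_left _ _).trans_lt (hx.trans_le (le_max_left _ _)))
    (by
      rintro z ⟨hz1, hz2⟩
      rcases min_lt_iff.1 hz1 with h | h <;> rcases lt_max_iff.1 hz2 with h' | h'
      · exact hsub ⟨h, h'⟩
      · rcases le_or_gt z y with hzy | hzy
        · exact hsub ⟨h, hzy.trans_lt hy2⟩
        · exact ha k ⟨hk.1.trans_lt hzy, h'⟩
      · rcases lt_or_ge z y with hzy | hzy
        · exact ha k ⟨h, hzy.trans_le hk.2⟩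
        · exact hsub ⟨hy1.trans_le hzy, h'⟩
      · exact ha k ⟨h, h'⟩)
    (Set.Ioo_subset_Ioo (min_le_left _ _) (le_max_left _ _))
  have h1' : x₁ ≤ a k := min_eq_left_iff.1 h1
  have h2' : a k + δ ≤ x₂ := max_eq_left_iff.1 h2
  have haff : ∀ z ∈ Set.Icc x₁ x₂, u z = u x₁ + -Λ * (z - x₁) := fun z hz =>
    eq_affine_of_hasDerivAt_Ioo hu.cont (fun w hw => hsub hw) hz
  have hak := haff (a k) ⟨h1', by linarith⟩
  rw [hstart k] at hak
  have hx₁ : x₁ = a k := by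
    by_contra hne
    obtain ⟨z, hz1, hz2⟩ := exists_between (lt_of_le_of_ne h1' hne)
    have hb := (abs_le.1 (hbound z (hsub ⟨hz1, by linarith⟩))).2
    rw [haff z ⟨hz1.le, by linarith⟩] at hb
    nlinarith
  have hx₂ : x₂ = a k + δ := by
    by_contra hne
    obtain ⟨z, hz1, hz2⟩ := exists_between (lt_of_le_of_ne h2' (Ne.symm hne))
    have hb := (abs_le.1 (hbound z (hsub ⟨by linarith, hz2⟩))).1
    rw [haff z ⟨by linarith, hz2.le⟩] at hb
    nlinarith
  refine ⟨by rw [hx₂, hx₁], ?_⟩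
  rw [hx₂, hx₁, hstart k, htile k _ (Set.right_mem_Icc.2 (by linarith))]
  ring
end
end
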